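/- arXiv:2305.15034 — 3 statements merged into one kernel-verified Lean document; each statement's English description precedes it below -/
import Mathlib

section
/- There exists a constant c > 0, depending only on μ and γ₋, such that for every x ∈ (0,1] one has ∫_{(0,1]} α x^{−α} dμ(α) ≥ c · ∫_{(0,1]} x^{−α} dμ(α). -/
open MeasureTheory Real

/-- `μ` is a nonzero distributed-order measure supported in `(0,1]`: it has the form
`Σₙ qₙ δ_{αₙ} + w·(Lebesgue on (0,1))` with `0 < α₁ < ⋯ < α_M < 1`, `qₙ ≥ 0`, and a
nonnegative weight `w ∈ L¹((0,1))` (either part may vanish, but `μ ≠ 0`). -/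
def IsDistOrderMeasure (μ : Measure ℝ) : Prop :=
  μ ≠ 0 ∧
  ∃ (M : ℕ) (α : Fin M → ℝ) (q : Fin M → ℝ) (w : ℝ → ℝ),
    StrictMono α ∧ (∀ n, α n ∈ Set.Ioo (0:ℝ) 1) ∧ (∀ n, 0 ≤ q n) ∧
    (∀ x ∈ Set.Ioo (0:ℝ) 1, 0 ≤ w x) ∧
    MeasureTheory.IntegrableOn w (Set.Ioo 0 1) ∧
    μ = (∑ n, ENNReal.ofReal (q n) • MeasureTheory.Measure.dirac (α n)) +
        ((MeasureTheory.volume.restrict (Set.Ioo (0:ℝ) 1)).withDensity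
          fun x => ENNReal.ofReal (w x))

/-- Chebyshev's association inequality on `(0,1]` for the increasing functions `a ↦ a` and
`a ↦ x ^ (-a)`, with `m` at most the mean of `a`. -/
theorem mul_setIntegral_rpow_neg_le (μ : Measure ℝ) [IsFiniteMeasure μ] {m x : ℝ}
    (hm : m * μ.real (Set.Ioc 0 1) ≤ ∫ a in Set.Ioc (0:ℝ) 1, a ∂μ)
    (hx : x ∈ Set.Ioc (0:ℝ) 1) :
    m * ∫ a in Set.Ioc (0:ℝ) 1, x ^ (-a) ∂μ ≤
      ∫ a in Set.Ioc (0:ℝ) 1, a * x ^ (-a) ∂μ := by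
  have hcont : Continuous fun a : ℝ => x ^ (-a) :=
    continuous_const.rpow continuous_neg fun _ => Or.inl hx.1.ne'
  have hint : ∀ f : ℝ → ℝ, Continuous f → IntegrableOn f (Set.Ioc 0 1) μ := fun f hf =>
    (hf.continuousOn.integrableOn_compact isCompact_Icc).mono_set Set.Ioc_subset_Icc_self
  have hmono : Monotone fun a : ℝ => x ^ (-a) := fun a b hab =>
    rpow_le_rpow_of_exponent_ge hx.1 hx.2 (neg_le_neg hab)
  have hpt (a : ℝ) : m * x ^ (-a) + (a * x ^ (-m) - m * x ^ (-m)) ≤ a * x ^ (-a) := by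
    rcases le_total a m with h | h
    · nlinarith [hmono h]
    · nlinarith [hmono h]
  have hle := setIntegral_mono (hint _ (by fun_prop)) (hint _ (by fun_prop)) hpt
  rw [integral_add (hint _ (by fun_prop)) (hint _ (by fun_prop)),
    integral_sub (hint _ (by fun_prop)) (hint _ (by fun_prop)),
    integral_const_mul, integral_mul_const, setIntegral_const, smul_eq_mul] at hle
  nlinarith [mul_le_mul_of_nonneg_right hm (rpow_nonneg hx.1.le (-m))]

/-- There exists `c > 0`, depending only on `μ` and `γ₋`, such that for every `x ∈ (0,1]`,
`∫_{(0,1]} α x^{−α} dμ(α) ≥ c · ∫_{(0,1]} x^{−α} dμ(α)`. -/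
theorem statement1 (μ : Measure ℝ) [IsFiniteMeasure μ] (hμ : IsDistOrderMeasure μ)
    (γ : ℝ) (hγ : γ ∈ Set.Ioo (0:ℝ) 1) (hγμ : 0 < μ (Set.Ioc γ 1)) :
    ∃ c : ℝ, 0 < c ∧ ∀ x ∈ Set.Ioc (0:ℝ) 1,
      c * ∫ a in Set.Ioc (0:ℝ) 1, x ^ (-a) ∂μ ≤
        ∫ a in Set.Ioc (0:ℝ) 1, a * x ^ (-a) ∂μ := by
  have hS : 0 < μ (Set.Ioc 0 1) :=
    hγμ.trans_le (measure_mono (Set.Ioc_subset_Ioc_left hγ.1.le))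
  have hS' : 0 < μ.real (Set.Ioc 0 1) := ENNReal.toReal_pos hS.ne' (measure_ne_top _ _)
  have hpos : 0 < ∫ a in Set.Ioc (0:ℝ) 1, a ∂μ := by
    rw [setIntegral_pos_iff_support_of_nonneg_ae]
    · refine hS.trans_le (measure_mono fun a ha => ⟨ha.1.ne', ha⟩)
    · exact ae_restrict_of_forall_mem measurableSet_Ioc fun a ha => ha.1.le
    · exact (continuous_id.continuousOn.integrableOn_compact isCompact_Icc).mono_set
        Set.Ioc_subset_Icc_self
  exact ⟨(∫ a in Set.Ioc (0:ℝ) 1, a ∂μ) / μ.real (Set.Ioc 0 1), div_pos hpos hS',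
    fun x hx => mul_setIntegral_rpow_neg_le μ (div_mul_cancel₀ _ hS'.ne').le hx⟩
end

section
/- The function l is nonnegative on (0,∞), locally integrable on [0,∞), and satisfies (k ∗ l)(t) = ∫₀ᵗ k(t−τ) l(τ) dτ = 1 for every t > 0. -/
open MeasureTheory Real

/-- The kernel `k(t) = ∫_{(0,1]} t^{−α}/Γ(1−α) dμ(α)`. -/
noncomputable def kker (μ : Measure ℝ) (t : ℝ) : ℝ :=
  ∫ a in Set.Ioc (0:ℝ) 1, t ^ (-a) / Real.Gamma (1 - a) ∂μ

/-- `H(r)` from the representation formula for the kernel `l`. -/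
noncomputable def Hker (μ : Measure ℝ) (r : ℝ) : ℝ :=
  (∫ a in Set.Ioc (0:ℝ) 1, r ^ a * Real.sin (Real.pi * a) ∂μ) /
    ((∫ a in Set.Ioc (0:ℝ) 1, r ^ a * Real.sin (Real.pi * a) ∂μ) ^ 2 +
     (∫ a in Set.Ioc (0:ℝ) 1, r ^ a * Real.cos (Real.pi * a) ∂μ) ^ 2)

/-- The kernel `l(t) = (1/π) ∫₀^∞ e^{−rt} H(r) dr`. -/
noncomputable def lker (μ : Measure ℝ) (t : ℝ) : ℝ :=
  (1 / Real.pi) * ∫ r in Set.Ioi (0:ℝ), Real.exp (-(r * t)) * Hker μ r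

open Filter Topology ProbabilityTheory
open scoped ENNReal

theorem lintegral_exp_mul_eq_top_of_nonpos {G : ℝ → ℝ≥0∞}
    (h : ∀ s > (0:ℝ), ∫⁻ t in Set.Ioi (0:ℝ), ENNReal.ofReal (rexp (-(s * t))) * G t
      = ENNReal.ofReal (1 / s)) {s : ℝ} (hs : s ≤ 0) :
    ∫⁻ t in Set.Ioi (0:ℝ), ENNReal.ofReal (rexp (-(s * t))) * G t = ⊤ := by
  refine ENNReal.eq_top_of_forall_nnreal_le fun r => ?_
  have hr : (0:ℝ) < 1 / ((r:ℝ) + 1) := by positivity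
  calc (r : ℝ≥0∞) = ENNReal.ofReal r := by simp
    _ ≤ ENNReal.ofReal (1 / (1 / ((r:ℝ) + 1))) := by
        apply ENNReal.ofReal_le_ofReal; rw [one_div_one_div]; linarith
    _ = _ := (h _ hr).symm
    _ ≤ _ := by
        refine setLIntegral_mono' measurableSet_Ioi fun t ht => ?_
        gcongr
        · exact (Set.mem_Ioi.1 ht).le
        · linarith

theorem lintegral_exp_neg_mul_Ioi {s : ℝ} (hs : 0 < s) :
    ∫⁻ t in Set.Ioi (0:ℝ), ENNReal.ofReal (rexp (-(s * t))) = ENNReal.ofReal (1 / s) := by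
  have hi : IntegrableOn (fun t : ℝ => rexp (-(s * t))) (Set.Ioi 0) := by
    simpa [neg_mul] using exp_neg_integrableOn_Ioi 0 hs
  rw [← ofReal_integral_eq_lintegral_ofReal hi (Eventually.of_forall fun t => (exp_pos _).le)]
  congr 1
  have := Real.integral_rpow_mul_exp_neg_mul_Ioi (a := 1) one_pos hs
  simpa using this

/-- A nonnegative function on the half-line whose Laplace transform is `1 / s` is a.e. `1`. -/
theorem ae_eq_one_of_laplace_eq {G : ℝ → ℝ≥0∞} (hG : Measurable G)
    (h : ∀ s > (0:ℝ), ∫⁻ t in Set.Ioi (0:ℝ), ENNReal.ofReal (rexp (-(s * t))) * G t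
      = ENNReal.ofReal (1 / s)) :
    ∀ᵐ t ∂(volume.restrict (Set.Ioi (0:ℝ))), G t = 1 := by
  have h1 : ∀ s > (0:ℝ), ∫⁻ t in Set.Ioi (0:ℝ), ENNReal.ofReal (rexp (-(s * t))) * (1 : ℝ≥0∞)
      = ENNReal.ofReal (1 / s) := fun s hs => by
    simpa using lintegral_exp_neg_mul_Ioi hs
  set E : ℝ → ℝ≥0∞ := fun t => ENNReal.ofReal (rexp (-t)) with hE
  have hEm : Measurable E := by fun_prop
  set m : (ℝ → ℝ≥0∞) → Measure ℝ := fun f =>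
    (volume.restrict (Set.Ioi (0:ℝ))).withDensity (fun t => E t * f t) with hm
  have key : ∀ (f : ℝ → ℝ≥0∞), Measurable f → ∀ u : ℝ,
      ∫⁻ x, ENNReal.ofReal (rexp (u * x)) ∂(m f)
        = ∫⁻ t in Set.Ioi (0:ℝ), ENNReal.ofReal (rexp (-((1 - u) * t))) * f t := by
    intro f hf u
    have hme : Measurable fun x : ℝ => ENNReal.ofReal (rexp (u * x)) := by fun_prop
    refine (lintegral_withDensity_eq_lintegral_mul _ (hEm.mul hf) hme).trans ?_
    refine lintegral_congr fun t => ?_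
    simp only [Pi.mul_apply, hE]
    rw [mul_right_comm, ← ENNReal.ofReal_mul (exp_pos _).le, ← Real.exp_add]
    congr 3; ring
  have keyeq : ∀ u : ℝ, ∫⁻ x, ENNReal.ofReal (rexp (u * x)) ∂(m G)
      = ∫⁻ x, ENNReal.ofReal (rexp (u * x)) ∂(m fun _ => 1) := by
    intro u
    rw [key G hG, key _ measurable_const]
    rcases lt_or_ge u 1 with hu | hu
    · rw [h _ (by linarith), h1 _ (by linarith)]
    · rw [lintegral_exp_mul_eq_top_of_nonpos h (by linarith),
        lintegral_exp_mul_eq_top_of_nonpos h1 (by linarith)]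
  have huniv : ∀ (f : ℝ → ℝ≥0∞), Measurable f → (∀ s > (0:ℝ), ∫⁻ t in Set.Ioi (0:ℝ),
      ENNReal.ofReal (rexp (-(s * t))) * f t = ENNReal.ofReal (1 / s)) →
      m f Set.univ = 1 := by
    intro f hf hh
    have := key f hf 0
    rw [hh _ (by norm_num)] at this
    simpa using this
  have hGu := huniv G hG h
  have h1u := huniv _ measurable_const h1
  have : IsProbabilityMeasure (m G) := ⟨hGu⟩
  have : IsProbabilityMeasure (m fun _ => 1) := ⟨h1u⟩
  have hmgf : mgf id (m G) = mgf id (m fun _ => 1) := by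
    ext u
    simp only [mgf, id]
    rw [integral_eq_lintegral_of_nonneg_ae (Eventually.of_forall fun t => (exp_pos _).le)
      (by fun_prop), integral_eq_lintegral_of_nonneg_ae
      (Eventually.of_forall fun t => (exp_pos _).le) (by fun_prop), keyeq]
  have hint : Set.Iio (1:ℝ) ⊆ integrableExpSet id (m G) := by
    intro u hu
    refine ⟨by fun_prop, ?_⟩
    rw [hasFiniteIntegral_iff_ofReal (Eventually.of_forall fun t => (exp_pos _).le)]
    simp only [id]
    rw [key G hG, h _ (by simpa using hu)]
    exact ENNReal.ofReal_lt_top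
  have h0 : (0:ℝ) ∈ interior (integrableExpSet id (m G)) :=
    interior_maximal hint isOpen_Iio (by simp)
  have heq := eqOn_complexMGF_of_mgf hmgf
  have hmm : m G = m fun _ => 1 := by
    refine Measure.ext_of_charFun ?_
    ext t
    rw [← complexMGF_id_mul_I, ← complexMGF_id_mul_I]
    exact heq (by simpa using h0)
  rw [hm] at hmm
  have := (withDensity_eq_iff (hEm.mul hG).aemeasurable (hEm.mul measurable_const).aemeasurable
    ?_).1 hmm
  · filter_upwards [this] with t ht
    have hpos : E t ≠ 0 := by simp [hE, exp_pos]
    exact (ENNReal.mul_right_inj hpos ENNReal.ofReal_ne_top).1 ht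
  · have : m G Set.univ ≠ ⊤ := by rw [hGu]; simp
    rwa [hm, withDensity_apply _ MeasurableSet.univ, Measure.restrict_univ] at this

/-- The numerator `∫ r ^ a sin (π a) dν(a)` of `Hker`, in the logarithmic variable `r = exp x`. -/
noncomputable def sinMGF (ν : Measure ℝ) (x : ℝ) : ℝ :=
  ∫ a, rexp (x * a) * Real.sin (π * a) ∂ν

section UnitInterval

variable {ν : Measure ℝ}

theorem integrable_of_continuous [IsFiniteMeasure ν] (hν : ∀ᵐ a ∂ν, a ∈ Set.Ioo (0:ℝ) 1)
    {E : Type*} [NormedAddCommGroup E] {f : ℝ → E} (hf : Continuous f) :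
    Integrable f ν := by
  have h1 : ν.restrict (Set.Icc 0 1) = ν :=
    Measure.restrict_eq_self_of_ae_mem (hν.mono fun a ha => Set.Ioo_subset_Icc_self ha)
  rw [← h1]
  exact hf.continuousOn.integrableOn_compact isCompact_Icc

theorem differentiable_complexMGF_id [IsFiniteMeasure ν] (hν : ∀ᵐ a ∂ν, a ∈ Set.Ioo (0:ℝ) 1) :
    Differentiable ℂ (complexMGF id ν) := by
  intro z
  refine (hasDerivAt_complexMGF ?_).differentiableAt
  have : integrableExpSet id ν = Set.univ :=
    Set.eq_univ_of_forall fun u => integrable_of_continuous hν (by simp only [id]; fun_prop)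
  simp [this]

theorem sin_pi_mul_pos {a : ℝ} (ha : a ∈ Set.Ioo (0:ℝ) 1) : 0 < Real.sin (π * a) :=
  Real.sin_pos_of_pos_of_lt_pi (mul_pos pi_pos ha.1) (by nlinarith [pi_pos, ha.2])

theorem sinMGF_pos [IsFiniteMeasure ν] [NeZero ν] (hν : ∀ᵐ a ∂ν, a ∈ Set.Ioo (0:ℝ) 1) (x : ℝ) :
    0 < sinMGF ν x := by
  have hp : ∀ᵐ a ∂ν, 0 < rexp (x * a) * Real.sin (π * a) :=
    hν.mono fun a ha => mul_pos (exp_pos _) (sin_pi_mul_pos ha)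
  rw [sinMGF, integral_pos_iff_support_of_nonneg_ae (hp.mono fun a ha => ha.le)
    (integrable_of_continuous hν (by fun_prop))]
  rw [measure_eq_measure_of_null_sdiff (Set.subset_univ _)]
  · simpa using NeZero.ne ν
  · refine measure_mono_null ?_ (ae_iff.1 hp)
    intro a ha hpos
    exact ha.2 (ne_of_gt hpos)

theorem complexMGF_im_pi [IsFiniteMeasure ν] (hν : ∀ᵐ a ∂ν, a ∈ Set.Ioo (0:ℝ) 1) (x : ℝ) :
    (complexMGF id ν (x + π * Complex.I)).im = sinMGF ν x := by
  have hi : Integrable (fun a : ℝ => Complex.exp ((x + π * Complex.I) * a)) ν :=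
    integrable_of_continuous hν (by fun_prop)
  have := Complex.imCLM.integral_comp_comm hi
  simp only [Complex.imCLM_apply] at this
  simp only [complexMGF, id, sinMGF]
  rw [← this]
  refine integral_congr_ae (Eventually.of_forall fun a => ?_)
  simp [Complex.exp_im]

theorem complexMGF_conj (z : ℂ) :
    complexMGF id ν (starRingEnd ℂ z) = starRingEnd ℂ (complexMGF id ν z) := by
  simp only [complexMGF, id]
  rw [← integral_conj]
  simp [← Complex.exp_conj]

theorem sinMGF_le_norm_complexMGF [IsFiniteMeasure ν] (hν : ∀ᵐ a ∂ν, a ∈ Set.Ioo (0:ℝ) 1)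
    (x : ℝ) {y : ℝ} (hy : |y| ≤ π) :
    sinMGF ν x ≤ ‖complexMGF id ν (x + y * Complex.I)‖ := by
  set c : ℂ := Complex.exp ((-(y / 2) : ℝ) * Complex.I) with hc
  have hcn : ‖c‖ = 1 := Complex.norm_exp_ofReal_mul_I _
  have hi : Integrable (fun a : ℝ => c * Complex.exp ((x + y * Complex.I) * a)) ν :=
    integrable_of_continuous hν (by fun_prop)
  have h1 := Complex.reCLM.integral_comp_comm hi
  simp only [Complex.reCLM_apply] at h1
  calc sinMGF ν x ≤ ∫ a : ℝ, (c * Complex.exp ((x + y * Complex.I) * a)).re ∂ν := by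
        refine integral_mono_ae (integrable_of_continuous hν (by fun_prop))
          (integrable_of_continuous hν (by fun_prop)) ?_
        filter_upwards [hν] with a ha
        have : (c * Complex.exp ((x + y * Complex.I) * a)).re
            = rexp (x * a) * Real.cos ((a - 1 / 2) * y) := by
          rw [hc, ← Complex.exp_add, Complex.exp_re]
          congr 2
          · simp
          · simp; ring
        rw [this]
        gcongr
        have h2 : Real.sin (π * a) = Real.cos (|a - 1 / 2| * π) := by
          rcases abs_cases (a - 1 / 2) with ⟨h, _⟩ | ⟨h, _⟩
          · rw [h, ← Real.cos_pi_div_two_sub, ← Real.cos_neg]; congr 1; ring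
          · rw [h, ← Real.cos_pi_div_two_sub]; congr 1; ring
        rw [h2, ← Real.cos_abs ((a - 1 / 2) * y), abs_mul]
        have h3 : |a - 1 / 2| ≤ 1 := by rw [abs_le]; constructor <;> linarith [ha.1, ha.2]
        exact Real.cos_le_cos_of_nonneg_of_le_pi (by positivity) (by nlinarith [pi_pos])
          (by gcongr)
    _ = (c * complexMGF id ν (x + y * Complex.I)).re := by
        rw [h1, integral_const_mul]; rfl
    _ ≤ ‖c * complexMGF id ν (x + y * Complex.I)‖ := Complex.re_le_norm _
    _ = _ := by rw [norm_mul, hcn, one_mul]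

theorem exists_sinMGF_lower_bound [IsFiniteMeasure ν] [NeZero ν]
    (hν : ∀ᵐ a ∂ν, a ∈ Set.Ioo (0:ℝ) 1) :
    ∃ δ > (0:ℝ), ∃ c > (0:ℝ), (∀ x ≥ (0:ℝ), c * rexp (δ * x) ≤ sinMGF ν x) ∧
      ∀ x ≤ (0:ℝ), c * rexp ((1 - δ) * x) ≤ sinMGF ν x := by
  obtain ⟨n, hn⟩ : ∃ n : ℕ, 0 < ν (Set.Icc (1 / ((n:ℝ) + 1)) (1 - 1 / ((n:ℝ) + 1))) := by
    by_contra! hcon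
    have h0 : ν (⋃ n : ℕ, Set.Icc (1 / ((n:ℝ) + 1)) (1 - 1 / ((n:ℝ) + 1))) = 0 :=
      measure_iUnion_null fun n => le_antisymm (hcon n) zero_le
    refine NeZero.ne ν (ae_eq_bot.1 (eventually_false_iff_eq_bot.1 ?_))
    filter_upwards [hν, measure_eq_zero_iff_ae_notMem.1 h0] with a ha hna
    obtain ⟨n, hn⟩ := exists_nat_one_div_lt (lt_min ha.1 (sub_pos.2 ha.2))
    refine hna (Set.mem_iUnion.2 ⟨n, ?_, ?_⟩)
    · exact (hn.le.trans (min_le_left _ _))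
    · linarith [hn.le.trans (min_le_right _ _)]
  set δ : ℝ := 1 / ((n:ℝ) + 1) with hδ
  have hδ0 : 0 < δ := by positivity
  have hsi : IntegrableOn (fun a : ℝ => Real.sin (π * a)) (Set.Icc δ (1 - δ)) ν :=
    (integrable_of_continuous hν (by fun_prop)).integrableOn
  have hsub : Set.Icc δ (1 - δ) ⊆ Set.Ioo 0 1 := fun a ha =>
    ⟨hδ0.trans_le ha.1, by linarith [ha.2]⟩
  have hc : 0 < ∫ a in Set.Icc δ (1 - δ), Real.sin (π * a) ∂ν := by
    rw [setIntegral_pos_iff_support_of_nonneg_ae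
      ((ae_restrict_mem measurableSet_Icc).mono fun a ha => (sin_pi_mul_pos (hsub ha)).le) hsi]
    refine hn.trans_le (measure_mono fun a ha => ⟨(sin_pi_mul_pos (hsub ha)).ne', ha⟩)
  have hbound : ∀ x m : ℝ, (∀ a ∈ Set.Icc δ (1 - δ), m ≤ x * a) →
      (∫ a in Set.Icc δ (1 - δ), Real.sin (π * a) ∂ν) * rexp m ≤ sinMGF ν x := by
    intro x m hm
    rw [mul_comm, ← integral_const_mul]
    have hI : Integrable (fun a : ℝ => rexp (x * a) * Real.sin (π * a)) ν :=
      integrable_of_continuous hν (by fun_prop)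
    refine (setIntegral_mono_on (hsi.const_mul _) hI.integrableOn measurableSet_Icc ?_).trans
      (setIntegral_le_integral hI ?_)
    · intro a ha
      have := (sin_pi_mul_pos (hsub ha)).le
      have := hm a ha
      gcongr
    · exact hν.mono fun a ha => (mul_pos (exp_pos _) (sin_pi_mul_pos ha)).le
  refine ⟨δ, hδ0, _, hc, fun x hx => hbound x _ fun a ha => ?_, fun x hx => hbound x _ fun a ha => ?_⟩
  · nlinarith [ha.1]
  · nlinarith [ha.2]

theorem tendsto_inv_sinMGF_atTop [IsFiniteMeasure ν] [NeZero ν]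
    (hν : ∀ᵐ a ∂ν, a ∈ Set.Ioo (0:ℝ) 1) :
    Tendsto (fun x => (sinMGF ν x)⁻¹) atTop (𝓝 0) := by
  obtain ⟨δ, hδ, c, hc, h, -⟩ := exists_sinMGF_lower_bound hν
  refine Tendsto.inv_tendsto_atTop ?_
  refine tendsto_atTop_mono' _ ((eventually_ge_atTop 0).mono h) ?_
  exact (tendsto_exp_atTop.comp (tendsto_id.const_mul_atTop hδ)).const_mul_atTop hc

theorem tendsto_exp_mul_inv_sinMGF_neg [IsFiniteMeasure ν] [NeZero ν]
    (hν : ∀ᵐ a ∂ν, a ∈ Set.Ioo (0:ℝ) 1) :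
    Tendsto (fun x => rexp (-x) * (sinMGF ν (-x))⁻¹) atTop (𝓝 0) := by
  obtain ⟨δ, hδ, c, hc, -, h⟩ := exists_sinMGF_lower_bound hν
  have h1 : Tendsto (fun x => (c * rexp (δ * x))⁻¹) atTop (𝓝 0) :=
    Tendsto.inv_tendsto_atTop
      ((tendsto_exp_atTop.comp (tendsto_id.const_mul_atTop hδ)).const_mul_atTop hc)
  refine squeeze_zero' (Eventually.of_forall fun x =>
    mul_nonneg (exp_pos _).le (inv_nonneg.2 (sinMGF_pos hν _).le)) ?_ h1
  filter_upwards [eventually_ge_atTop 0] with x hx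
  calc rexp (-x) * (sinMGF ν (-x))⁻¹ ≤ rexp (-x) * (c * rexp ((1 - δ) * -x))⁻¹ := by
        gcongr; exact h _ (by linarith)
    _ = (c * rexp (δ * x))⁻¹ := by
        have : rexp ((1 - δ) * -x) = rexp (δ * x) * rexp (-x) := by
          rw [← Real.exp_add]; congr 1; ring
        rw [this]; field_simp

theorem complexMGF_ne_zero [IsFiniteMeasure ν] [NeZero ν] (hν : ∀ᵐ a ∂ν, a ∈ Set.Ioo (0:ℝ) 1)
    {z : ℂ} (hz : |z.im| ≤ π) : complexMGF id ν z ≠ 0 := by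
  have := (sinMGF_pos hν z.re).trans_le (sinMGF_le_norm_complexMGF hν z.re hz)
  rw [Complex.re_add_im] at this
  exact norm_pos_iff.1 this

theorem norm_inv_complexMGF_le [IsFiniteMeasure ν] [NeZero ν]
    (hν : ∀ᵐ a ∂ν, a ∈ Set.Ioo (0:ℝ) 1) (x : ℝ) {y : ℝ} (hy : |y| ≤ π) :
    ‖(complexMGF id ν (x + y * Complex.I))⁻¹‖ ≤ (sinMGF ν x)⁻¹ := by
  rw [norm_inv]
  exact inv_anti₀ (sinMGF_pos hν x) (sinMGF_le_norm_complexMGF hν x hy)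

theorem dslope_exp_ne_zero {x : ℝ} {z : ℂ} (hz : |z.im| ≤ π) :
    dslope Complex.exp (x : ℂ) z ≠ 0 := by
  by_cases h : z = x
  · rw [h, dslope_same, Complex.deriv_exp]; exact Complex.exp_ne_zero _
  · rw [dslope_of_ne _ h, slope_def_field]
    refine div_ne_zero (fun h0 => h ?_) (sub_ne_zero.2 h)
    obtain ⟨n, hn⟩ := Complex.exp_eq_exp_iff_exists_int.1 (sub_eq_zero.1 h0)
    have him : z.im = n * (2 * π) := by rw [hn]; simp
    have hn0 : n = 0 := by
      rw [him, abs_mul, abs_of_pos two_pi_pos] at hz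
      have h1 : |(n:ℝ)| < 1 := by
        by_contra! h1
        nlinarith [pi_pos]
      exact Int.abs_lt_one_iff.1 (by exact_mod_cast h1)
    simpa [hn0] using hn

/-- The Cauchy kernel for `1 / complexMGF` at the real point `x₀`, in the logarithmic variable and
with its singularity removed. -/
noncomputable def cauchyKer (ν : Measure ℝ) (x₀ : ℝ) (z : ℂ) : ℂ :=
  dslope (fun z => (complexMGF id ν z)⁻¹) (x₀ : ℂ) z / dslope Complex.exp (x₀ : ℂ) z * Complex.exp z

theorem cauchyKer_of_ne {x₀ : ℝ} {z : ℂ} (h : z ≠ x₀) :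
    cauchyKer ν x₀ z = ((complexMGF id ν z)⁻¹ - (mgf id ν x₀ : ℂ)⁻¹) * Complex.exp z /
      (Complex.exp z - rexp x₀) := by
  have : z - x₀ ≠ 0 := sub_ne_zero.2 h
  rw [cauchyKer, dslope_of_ne _ h, dslope_of_ne _ h, slope_def_field, slope_def_field,
    complexMGF_ofReal, div_div_div_cancel_right₀ this, Complex.ofReal_exp]
  ring

theorem differentiableOn_cauchyKer [IsFiniteMeasure ν] [NeZero ν]
    (hν : ∀ᵐ a ∂ν, a ∈ Set.Ioo (0:ℝ) 1) {x₀ R : ℝ} (hR : |x₀| < R) :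
    DifferentiableOn ℂ (cauchyKer ν x₀) (Set.Icc (-R) R ×ℂ Set.Icc (-π) π) := by
  have hnhds : Set.Icc (-R) R ×ℂ Set.Icc (-π) π ∈ 𝓝 (x₀ : ℂ) := by
    refine mem_of_superset ((isOpen_Ioo.reProdIm isOpen_Ioo).mem_nhds
      (?_ : (x₀ : ℂ) ∈ Set.Ioo (-R) R ×ℂ Set.Ioo (-π) π))
      (Set.inter_subset_inter (Set.preimage_mono Set.Ioo_subset_Icc_self)
        (Set.preimage_mono Set.Ioo_subset_Icc_self))
    exact ⟨abs_lt.1 hR, by simp [pi_pos]⟩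
  have him : ∀ z ∈ Set.Icc (-R) R ×ℂ Set.Icc (-π) π, |z.im| ≤ π := fun z hz => abs_le.2 hz.2
  have h1 : DifferentiableOn ℂ (fun z => (complexMGF id ν z)⁻¹) (Set.Icc (-R) R ×ℂ Set.Icc (-π) π) :=
    (differentiable_complexMGF_id hν).differentiableOn.inv
      fun z hz => complexMGF_ne_zero hν (him z hz)
  exact (((Complex.differentiableOn_dslope hnhds).2 h1).div
    ((Complex.differentiableOn_dslope hnhds).2 Complex.differentiable_exp.differentiableOn)
    fun z hz => dslope_exp_ne_zero (him z hz)).mul Complex.differentiable_exp.differentiableOn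

/-- `Hker`, as a function of the logarithmic variable. -/
noncomputable def logH (ν : Measure ℝ) (x : ℝ) : ℝ :=
  sinMGF ν x / Complex.normSq (complexMGF id ν (x + π * Complex.I))

theorem continuous_logH [IsFiniteMeasure ν] [NeZero ν] (hν : ∀ᵐ a ∂ν, a ∈ Set.Ioo (0:ℝ) 1) :
    Continuous (logH ν) := by
  have h1 : Continuous fun x : ℝ => complexMGF id ν (x + π * Complex.I) :=
    (differentiable_complexMGF_id hν).continuous.comp (by fun_prop)
  have h2 : Continuous (sinMGF ν) := by
    have : sinMGF ν = fun x : ℝ => (complexMGF id ν (x + π * Complex.I)).im :=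
      funext fun x => (complexMGF_im_pi hν x).symm
    rw [this]
    exact Complex.continuous_im.comp h1
  refine h2.div (Complex.continuous_normSq.comp h1) fun x => ?_
  exact Complex.normSq_eq_zero.not.2 (complexMGF_ne_zero hν (by simp [abs_of_pos pi_pos]))

theorem logH_pos [IsFiniteMeasure ν] [NeZero ν] (hν : ∀ᵐ a ∂ν, a ∈ Set.Ioo (0:ℝ) 1) (x : ℝ) :
    0 < logH ν x :=
  div_pos (sinMGF_pos hν x)
    (Complex.normSq_pos.2 (complexMGF_ne_zero hν (by simp [abs_of_pos pi_pos])))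

theorem cauchyKer_sub_cauchyKer [IsFiniteMeasure ν] (hν : ∀ᵐ a ∂ν, a ∈ Set.Ioo (0:ℝ) 1)
    (x₀ x : ℝ) :
    cauchyKer ν x₀ (x + (-π : ℝ) * Complex.I) - cauchyKer ν x₀ (x + π * Complex.I) =
      2 * Complex.I * ((logH ν x * (rexp x / (rexp x + rexp x₀)) : ℝ) : ℂ) := by
  have hne : ∀ y : ℝ, y ≠ 0 → (x + y * Complex.I : ℂ) ≠ x₀ := by
    intro y hy h
    have := congrArg Complex.im h
    simp [hy] at this
  have he : Complex.exp (x + π * Complex.I) = -(rexp x : ℂ) := by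
    rw [Complex.exp_add, Complex.exp_pi_mul_I]; simp
  have he' : Complex.exp (x + (-π : ℝ) * Complex.I) = -(rexp x : ℂ) := by
    rw [Complex.exp_add, Complex.ofReal_neg, neg_mul, Complex.exp_neg, Complex.exp_pi_mul_I]
    simp
  have hconj : (x + (-π : ℝ) * Complex.I : ℂ) = starRingEnd ℂ (x + π * Complex.I) := by
    simp
  have hpos : (rexp x + rexp x₀ : ℂ) ≠ 0 := by
    exact_mod_cast (add_pos (exp_pos x) (exp_pos x₀)).ne'
  rw [cauchyKer_of_ne (hne _ (neg_ne_zero.2 pi_ne_zero)), cauchyKer_of_ne (hne _ pi_ne_zero), he, he',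
    hconj, complexMGF_conj]
  set w := complexMGF id ν (x + π * Complex.I) with hw
  have h1 : (starRingEnd ℂ w)⁻¹ - w⁻¹ = 2 * Complex.I * (logH ν x : ℂ) := by
    have h2 := Complex.sub_conj (starRingEnd ℂ w⁻¹)
    rw [Complex.conj_conj, map_inv₀] at h2
    rw [h2, ← map_inv₀, Complex.conj_im, Complex.inv_im, hw, complexMGF_im_pi hν, logH]
    push_cast; ring
  have h3 : (-(rexp x : ℂ) - rexp x₀) = -(rexp x + rexp x₀ : ℂ) := by ring
  rw [h3, div_neg, div_neg, ← neg_div, ← neg_div, ← sub_div]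
  push_cast
  rw [← mul_assoc, ← h1, mul_div_assoc']
  congr 1
  ring

theorem tendsto_integral_cauchyKer_right [IsFiniteMeasure ν] [NeZero ν]
    (hν : ∀ᵐ a ∂ν, a ∈ Set.Ioo (0:ℝ) 1) (x₀ : ℝ) :
    Tendsto (fun R : ℝ => ∫ y in (-π)..π, cauchyKer ν x₀ (R + y * Complex.I)) atTop
      (𝓝 (-(2 * π * (mgf id ν x₀ : ℂ)⁻¹))) := by
  set f₀ : ℂ := (mgf id ν x₀ : ℂ)⁻¹ with hf₀
  set s := rexp x₀ with hs
  set b : ℝ → ℝ := fun R => ((sinMGF ν R)⁻¹ + ‖f₀‖ * s * rexp (-R)) / (1 - s * rexp (-R)) with hb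
  have he0 : Tendsto (fun R : ℝ => rexp (-R)) atTop (𝓝 0) := tendsto_exp_neg_atTop_nhds_zero
  have hbt : Tendsto b atTop (𝓝 0) := by
    have := ((tendsto_inv_sinMGF_atTop hν).add (he0.const_mul (‖f₀‖ * s))).div
      (tendsto_const_nhds.sub (he0.const_mul s) : Tendsto _ _ (𝓝 ((1:ℝ) - s * 0))) (by simp)
    simp only [mul_zero, add_zero, zero_div] at this
    exact this
  rw [tendsto_iff_norm_sub_tendsto_zero]
  have hbt' : Tendsto (fun R => b R * |π - (-π)|) atTop (𝓝 0) := by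
    simpa using hbt.mul_const |π - (-π)|
  refine squeeze_zero' (Eventually.of_forall fun R => norm_nonneg _) ?_ hbt'
  filter_upwards [eventually_gt_atTop |x₀|] with R hR
  have hxR : x₀ < R := (le_abs_self _).trans_lt hR
  have hcont : ContinuousOn (fun y : ℝ => cauchyKer ν x₀ (R + y * Complex.I))
      (Set.uIcc (-π) π) := by
    refine (differentiableOn_cauchyKer hν hR).continuousOn.comp (by fun_prop) ?_
    intro y hy
    rw [Set.uIcc_of_le (by linarith [pi_pos])] at hy
    have hR0 : 0 < R := (abs_nonneg _).trans_lt hR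
    exact ⟨by simp [hR0.le], by simpa using hy⟩
  have hconst : -(2 * π * f₀) = ∫ _ in (-π)..π, (-f₀) := by
    rw [intervalIntegral.integral_const, Complex.real_smul]; push_cast; ring
  rw [hconst, ← intervalIntegral.integral_sub hcont.intervalIntegrable (by simp)]
  refine intervalIntegral.norm_integral_le_of_norm_le_const fun y hy => ?_
  rw [Set.uIoc_of_le (by linarith [pi_pos])] at hy
  have hy' : |y| ≤ π := abs_le.2 ⟨hy.1.le, hy.2⟩
  have hne : (R + y * Complex.I : ℂ) ≠ x₀ := by
    intro h
    have := congrArg Complex.re h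
    simp at this; exact hxR.ne' this
  rw [cauchyKer_of_ne hne]
  set z : ℂ := R + y * Complex.I with hz
  have hnz : ‖Complex.exp z‖ = rexp R := by rw [Complex.norm_exp]; simp [hz]
  have hns : ‖(s : ℂ)‖ = s := by simp [hs]
  have hlow : rexp R - s ≤ ‖Complex.exp z - s‖ := by
    have := norm_sub_norm_le (Complex.exp z) (s : ℂ)
    rwa [hnz, hns] at this
  have hpos : 0 < rexp R - s := sub_pos.2 (Real.exp_lt_exp.2 hxR)
  have hne2 : Complex.exp z - s ≠ 0 := norm_pos_iff.1 (hpos.trans_le hlow)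
  have heq : ((complexMGF id ν z)⁻¹ - f₀) * Complex.exp z / (Complex.exp z - s) - -f₀
      = ((complexMGF id ν z)⁻¹ * Complex.exp z - f₀ * s) / (Complex.exp z - s) := by
    rw [eq_div_iff hne2, sub_mul, div_mul_cancel₀ _ hne2]; ring
  rw [heq, norm_div]
  have hF := norm_inv_complexMGF_le hν R hy'
  have hσ := sinMGF_pos hν R
  calc _ ≤ ((sinMGF ν R)⁻¹ * rexp R + ‖f₀‖ * s) / (rexp R - s) := by
        gcongr
        refine (norm_sub_le _ _).trans ?_
        rw [norm_mul, norm_mul, hnz, hns]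
        gcongr
    _ = b R := by
        have h1 : rexp (-R) = (rexp R)⁻¹ := Real.exp_neg R
        have h2 : 1 - s * (rexp R)⁻¹ ≠ 0 := by
          have : 1 - s * (rexp R)⁻¹ = (rexp R - s) * (rexp R)⁻¹ := by
            have := (exp_pos R).ne'; field_simp
          rw [this]; exact mul_ne_zero hpos.ne' (inv_ne_zero (exp_pos R).ne')
        simp only [hb, h1]
        rw [div_eq_div_iff hpos.ne' h2]
        have := (exp_pos R).ne'
        field_simp

theorem tendsto_integral_cauchyKer_left [IsFiniteMeasure ν] [NeZero ν]
    (hν : ∀ᵐ a ∂ν, a ∈ Set.Ioo (0:ℝ) 1) (x₀ : ℝ) :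
    Tendsto (fun R : ℝ => ∫ y in (-π)..π, cauchyKer ν x₀ ((-R : ℝ) + y * Complex.I)) atTop
      (𝓝 0) := by
  set f₀ : ℂ := (mgf id ν x₀ : ℂ)⁻¹ with hf₀
  set s := rexp x₀ with hs
  set b : ℝ → ℝ := fun R =>
    (rexp (-R) * (sinMGF ν (-R))⁻¹ + ‖f₀‖ * rexp (-R)) / (s - rexp (-R)) with hb
  have he0 : Tendsto (fun R : ℝ => rexp (-R)) atTop (𝓝 0) := tendsto_exp_neg_atTop_nhds_zero
  have hs0 : 0 < s := exp_pos _
  have hbt : Tendsto b atTop (𝓝 0) := by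
    have := ((tendsto_exp_mul_inv_sinMGF_neg hν).add (he0.const_mul ‖f₀‖)).div
      (tendsto_const_nhds.sub he0 : Tendsto _ _ (𝓝 (s - 0))) (by simpa using hs0.ne')
    simp only [mul_zero, add_zero, zero_div] at this
    exact this
  rw [tendsto_zero_iff_norm_tendsto_zero]
  have hbt' : Tendsto (fun R => b R * |π - (-π)|) atTop (𝓝 0) := by
    simpa using hbt.mul_const |π - (-π)|
  refine squeeze_zero' (Eventually.of_forall fun R => norm_nonneg _) ?_ hbt'
  filter_upwards [eventually_gt_atTop |x₀|] with R hR
  have hxR : -R < x₀ := (abs_lt.1 hR).1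
  refine intervalIntegral.norm_integral_le_of_norm_le_const fun y hy => ?_
  rw [Set.uIoc_of_le (by linarith [pi_pos])] at hy
  have hy' : |y| ≤ π := abs_le.2 ⟨hy.1.le, hy.2⟩
  have hne : ((-R : ℝ) + y * Complex.I : ℂ) ≠ x₀ := by
    intro h
    have := congrArg Complex.re h
    simp at this; exact hxR.ne this
  rw [cauchyKer_of_ne hne]
  set z : ℂ := (-R : ℝ) + y * Complex.I with hz
  have hnz : ‖Complex.exp z‖ = rexp (-R) := by rw [Complex.norm_exp]; simp [hz]
  have hns : ‖(s : ℂ)‖ = s := by simp [hs]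
  have hlow : s - rexp (-R) ≤ ‖Complex.exp z - s‖ := by
    have := norm_sub_norm_le (s : ℂ) (Complex.exp z)
    rwa [hnz, hns, norm_sub_rev] at this
  have hpos : 0 < s - rexp (-R) := sub_pos.2 (Real.exp_lt_exp.2 hxR)
  have hF := norm_inv_complexMGF_le hν (-R) hy'
  have hσ := sinMGF_pos hν (-R)
  rw [norm_div, norm_mul, hnz]
  simp only [hb]
  have hnum : ‖(complexMGF id ν z)⁻¹ - f₀‖ * rexp (-R)
      ≤ rexp (-R) * (sinMGF ν (-R))⁻¹ + ‖f₀‖ * rexp (-R) := by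
    rw [mul_comm (rexp (-R)), ← add_mul]
    gcongr
    exact (norm_sub_le _ _).trans (by gcongr)
  gcongr

/-- The Stieltjes representation of `1 / mgf`, in the logarithmic variable. -/
theorem integral_logH [IsFiniteMeasure ν] [NeZero ν]
    (hν : ∀ᵐ a ∂ν, a ∈ Set.Ioo (0:ℝ) 1) (x₀ : ℝ) :
    Integrable (fun x => logH ν x * (rexp x / (rexp x + rexp x₀))) ∧
      ∫ x, logH ν x * (rexp x / (rexp x + rexp x₀)) = π * (mgf id ν x₀)⁻¹ := by
  set h : ℝ → ℝ := fun x => logH ν x * (rexp x / (rexp x + rexp x₀)) with hh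
  have hcont : Continuous h := by
    refine (continuous_logH hν).mul (Continuous.div (by fun_prop) (by fun_prop) fun x => ?_)
    exact (add_pos (exp_pos x) (exp_pos x₀)).ne'
  have hpos : ∀ x, 0 ≤ h x := fun x => mul_nonneg (logH_pos hν x).le (by positivity)
  have hlim : Tendsto (fun R : ℝ => ∫ x in (-R)..R, h x) atTop (𝓝 (π * (mgf id ν x₀)⁻¹)) := by
    have hC : Tendsto (fun R : ℝ => ((∫ x in (-R)..R, h x : ℝ) : ℂ)) atTop
        (𝓝 ((0 - -(2 * π * (mgf id ν x₀ : ℂ)⁻¹)) / 2)) := by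
      refine (((tendsto_integral_cauchyKer_left hν x₀).sub
        (tendsto_integral_cauchyKer_right hν x₀)).div_const 2).congr' ?_
      filter_upwards [eventually_gt_atTop |x₀|] with R hR
      have hR0 : 0 < R := (abs_nonneg _).trans_lt hR
      have hd := differentiableOn_cauchyKer hν hR
      have hR1 : -R ≤ R := by linarith
      have hpi : -π ≤ π := by linarith [pi_pos]
      have hedge : ∀ y : ℝ, |y| ≤ π → IntervalIntegrable
          (fun x : ℝ => cauchyKer ν x₀ (x + y * Complex.I)) volume (-R) R := by
        intro y hy
        refine ContinuousOn.intervalIntegrable (hd.continuousOn.comp (by fun_prop) ?_)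
        intro x hx
        rw [Set.uIcc_of_le hR1] at hx
        exact ⟨by simpa using hx, by simpa using abs_le.1 hy⟩
      have hrect := Complex.integral_boundary_rect_eq_zero_of_differentiableOn (cauchyKer ν x₀)
        ⟨-R, -π⟩ ⟨R, π⟩ (by simpa [Set.uIcc_of_le hR1, Set.uIcc_of_le hpi] using hd)
      simp only at hrect
      rw [← intervalIntegral.integral_sub (hedge _ (by simp [abs_of_pos pi_pos]))
        (hedge _ (by simp [abs_of_pos pi_pos]))] at hrect
      simp_rw [cauchyKer_sub_cauchyKer hν] at hrect
      rw [intervalIntegral.integral_const_mul, intervalIntegral.integral_ofReal] at hrect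
      simp only [smul_eq_mul] at hrect
      have hI := Complex.I_ne_zero
      refine mul_left_cancel₀ hI ?_
      linear_combination (-1 / 2 : ℂ) * hrect
    have := (Complex.continuous_re.tendsto _).comp hC
    refine (this.congr fun R => by simp).trans_eq ?_
    congr 1
    have : (0 - -(2 * π * (mgf id ν x₀ : ℂ)⁻¹)) / 2 = ((π * (mgf id ν x₀)⁻¹ : ℝ) : ℂ) := by
      push_cast; ring
    rw [this, Complex.ofReal_re]
  have hint : Integrable h := by
    refine integrable_of_intervalIntegral_norm_tendsto (π * (mgf id ν x₀)⁻¹)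
      (fun R => (hcont.integrableOn_Icc (a := -R) (b := R)).mono_set Set.Ioc_subset_Icc_self)
      tendsto_neg_atTop_atBot tendsto_id ?_
    simpa only [Real.norm_of_nonneg (hpos _), id] using hlim
  exact ⟨hint, tendsto_nhds_unique
    (intervalIntegral_tendsto_integral hint tendsto_neg_atTop_atBot tendsto_id) hlim⟩

theorem complexMGF_re_pi [IsFiniteMeasure ν] (hν : ∀ᵐ a ∂ν, a ∈ Set.Ioo (0:ℝ) 1) (x : ℝ) :
    (complexMGF id ν (x + π * Complex.I)).re = ∫ a, rexp (x * a) * Real.cos (π * a) ∂ν := by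
  have hi : Integrable (fun a : ℝ => Complex.exp ((x + π * Complex.I) * a)) ν :=
    integrable_of_continuous hν (by fun_prop)
  have := Complex.reCLM.integral_comp_comm hi
  simp only [Complex.reCLM_apply] at this
  simp only [complexMGF, id]
  rw [← this]
  refine integral_congr_ae (Eventually.of_forall fun a => ?_)
  simp [Complex.exp_re]

theorem restrict_Ioc_eq_self (hν : ∀ᵐ a ∂ν, a ∈ Set.Ioo (0:ℝ) 1) :
    ν.restrict (Set.Ioc (0:ℝ) 1) = ν :=
  Measure.restrict_eq_self_of_ae_mem (hν.mono fun _ ha => Set.Ioo_subset_Ioc_self ha)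

theorem Hker_exp [IsFiniteMeasure ν] (hν : ∀ᵐ a ∂ν, a ∈ Set.Ioo (0:ℝ) 1) (x : ℝ) :
    Hker ν (rexp x) = logH ν x := by
  simp only [Hker, restrict_Ioc_eq_self hν, logH, Complex.normSq_apply, complexMGF_re_pi hν,
    complexMGF_im_pi hν, sinMGF, ← Real.exp_mul]
  congr 1
  ring

theorem Hker_pos [IsFiniteMeasure ν] [NeZero ν] (hν : ∀ᵐ a ∂ν, a ∈ Set.Ioo (0:ℝ) 1) {r : ℝ}
    (hr : 0 < r) : 0 < Hker ν r := by
  rw [← Real.exp_log hr, Hker_exp hν]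
  exact logH_pos hν _

theorem continuousOn_Hker [IsFiniteMeasure ν] [NeZero ν] (hν : ∀ᵐ a ∂ν, a ∈ Set.Ioo (0:ℝ) 1) :
    ContinuousOn (Hker ν) (Set.Ioi 0) := by
  have : ContinuousOn (fun r => logH ν (Real.log r)) (Set.Ioi 0) :=
    (continuous_logH hν).comp_continuousOn
      (Real.continuousOn_log.mono fun r hr => (Set.mem_Ioi.1 hr).ne')
  refine this.congr fun r hr => ?_
  simp only [← Hker_exp hν, Real.exp_log (Set.mem_Ioi.1 hr)]

/-- The kernel `kker` as a lower Lebesgue integral. -/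
noncomputable def lintegralK (ν : Measure ℝ) (t : ℝ) : ℝ≥0∞ :=
  ∫⁻ a, ENNReal.ofReal (t ^ (-a) * (Real.Gamma (1 - a))⁻¹) ∂ν

/-- The kernel `lker` as a lower Lebesgue integral. -/
noncomputable def lintegralL (ν : Measure ℝ) (t : ℝ) : ℝ≥0∞ :=
  ENNReal.ofReal (1 / π) *
    ∫⁻ r in Set.Ioi (0:ℝ), ENNReal.ofReal (rexp (-(r * t))) * ENNReal.ofReal (Hker ν r)

theorem continuous_inv_Gamma_one_sub : Continuous fun a : ℝ => (Real.Gamma (1 - a))⁻¹ := by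
  have h : Continuous fun a : ℝ => ((Complex.Gamma ((1 - a : ℝ) : ℂ))⁻¹).re :=
    Complex.continuous_re.comp
      (Complex.differentiable_one_div_Gamma.continuous.comp (by fun_prop))
  refine h.congr fun a => ?_
  rw [Complex.Gamma_ofReal, ← Complex.ofReal_inv, Complex.ofReal_re]

theorem measurable_lintegralK [SFinite ν] : Measurable (lintegralK ν) := by
  refine Measurable.lintegral_prod_right' (f := fun p : ℝ × ℝ =>
    ENNReal.ofReal (p.1 ^ (-p.2) * (Real.Gamma (1 - p.2))⁻¹)) ?_
  have := continuous_inv_Gamma_one_sub.measurable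
  have h2 : Measurable fun p : ℝ × ℝ => (Real.Gamma (1 - p.2))⁻¹ := this.comp measurable_snd
  exact ((measurable_fst.pow measurable_snd.neg).mul h2).ennreal_ofReal

theorem aemeasurable_ofReal_Hker [IsFiniteMeasure ν] [NeZero ν]
    (hν : ∀ᵐ a ∂ν, a ∈ Set.Ioo (0:ℝ) 1) :
    AEMeasurable (fun r => ENNReal.ofReal (Hker ν r)) (volume.restrict (Set.Ioi 0)) :=
  ((continuousOn_Hker hν).aemeasurable measurableSet_Ioi).ennreal_ofReal

theorem antitone_lintegralL : Antitone (lintegralL ν) := by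
  intro t t' h
  refine mul_le_mul_right (setLIntegral_mono' measurableSet_Ioi fun r hr => ?_) _
  have : 0 ≤ r := (Set.mem_Ioi.1 hr).le
  gcongr

theorem measurable_lintegralL : Measurable (lintegralL ν) := antitone_lintegralL.measurable

theorem antitoneOn_lintegralK (hν : ∀ᵐ a ∂ν, a ∈ Set.Ioo (0:ℝ) 1) :
    AntitoneOn (lintegralK ν) (Set.Ioi 0) := by
  intro t ht t' ht' h
  refine lintegral_mono_ae (hν.mono fun a ha => ?_)
  have h1 : 0 < Real.Gamma (1 - a) := Real.Gamma_pos_of_pos (by linarith [ha.2])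
  gcongr ENNReal.ofReal (?_ * _)
  exact Real.rpow_le_rpow_of_nonpos ht h (by linarith [ha.1])

theorem integrable_kker [IsFiniteMeasure ν] (hν : ∀ᵐ a ∂ν, a ∈ Set.Ioo (0:ℝ) 1) {t : ℝ}
    (ht : 0 < t) : Integrable (fun a => t ^ (-a) * (Real.Gamma (1 - a))⁻¹) ν := by
  refine integrable_of_continuous hν (Continuous.mul ?_ continuous_inv_Gamma_one_sub)
  exact Continuous.rpow continuous_const continuous_neg fun _ => Or.inl ht.ne'

theorem kker_nonneg_integrand (hν : ∀ᵐ a ∂ν, a ∈ Set.Ioo (0:ℝ) 1) {t : ℝ} (ht : 0 < t) :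
    ∀ᵐ a ∂ν, 0 ≤ t ^ (-a) * (Real.Gamma (1 - a))⁻¹ :=
  hν.mono fun a ha => by
    have h1 : 0 < Real.Gamma (1 - a) := Real.Gamma_pos_of_pos (by linarith [ha.2])
    positivity

theorem lintegralK_ne_top [IsFiniteMeasure ν] (hν : ∀ᵐ a ∂ν, a ∈ Set.Ioo (0:ℝ) 1) {t : ℝ}
    (ht : 0 < t) : lintegralK ν t ≠ ⊤ := by
  rw [lintegralK, ← ofReal_integral_eq_lintegral_ofReal (integrable_kker hν ht)
    (kker_nonneg_integrand hν ht)]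
  exact ENNReal.ofReal_ne_top

theorem kker_eq_toReal [IsFiniteMeasure ν] (hν : ∀ᵐ a ∂ν, a ∈ Set.Ioo (0:ℝ) 1) {t : ℝ}
    (ht : 0 < t) : kker ν t = (lintegralK ν t).toReal := by
  rw [lintegralK, ← integral_eq_lintegral_of_nonneg_ae (kker_nonneg_integrand hν ht)
    (integrable_kker hν ht).aestronglyMeasurable]
  simp only [kker, restrict_Ioc_eq_self hν, div_eq_mul_inv]

theorem lker_eq_toReal [IsFiniteMeasure ν] [NeZero ν] (hν : ∀ᵐ a ∂ν, a ∈ Set.Ioo (0:ℝ) 1)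
    (t : ℝ) : lker ν t = (lintegralL ν t).toReal := by
  rw [lker, lintegralL, ENNReal.toReal_mul, ENNReal.toReal_ofReal (by positivity),
    integral_eq_lintegral_of_nonneg_ae]
  · simp_rw [ENNReal.ofReal_mul (exp_pos _).le]
  · exact (ae_restrict_mem measurableSet_Ioi).mono fun r hr =>
      mul_nonneg (exp_pos _).le (Hker_pos hν hr).le
  · exact (ContinuousOn.mul (by fun_prop) (continuousOn_Hker hν)).aestronglyMeasurable
      measurableSet_Ioi

theorem lker_nonneg [IsFiniteMeasure ν] [NeZero ν] (hν : ∀ᵐ a ∂ν, a ∈ Set.Ioo (0:ℝ) 1)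
    (t : ℝ) : 0 ≤ lker ν t := by
  rw [lker_eq_toReal hν]; exact ENNReal.toReal_nonneg

theorem lintegral_exp_mul_rpow {s a : ℝ} (hs : 0 < s) (ha : a < 1) :
    ∫⁻ t in Set.Ioi (0:ℝ), ENNReal.ofReal (rexp (-(s * t))) *
      ENNReal.ofReal (t ^ (-a) * (Real.Gamma (1 - a))⁻¹) = ENNReal.ofReal (s ^ (a - 1)) := by
  have hΓ : 0 < Real.Gamma (1 - a) := Real.Gamma_pos_of_pos (by linarith)
  have hI := Real.integral_rpow_mul_exp_neg_mul_Ioi (a := 1 - a) (by linarith) hs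
  have hI2 : ∫ t in Set.Ioi (0:ℝ), rexp (-(s * t)) * (t ^ (-a) * (Real.Gamma (1 - a))⁻¹)
      = s ^ (a - 1) := by
    have : ∀ t : ℝ, rexp (-(s * t)) * (t ^ (-a) * (Real.Gamma (1 - a))⁻¹)
        = (Real.Gamma (1 - a))⁻¹ * (t ^ (1 - a - 1) * rexp (-(s * t))) := fun t => by
      rw [show 1 - a - 1 = -a by ring]; ring
    simp_rw [this]
    rw [integral_const_mul, hI, one_div, Real.inv_rpow hs.le, ← Real.rpow_neg hs.le, neg_sub]
    field_simp
  have hint : IntegrableOn (fun t => rexp (-(s * t)) * (t ^ (-a) * (Real.Gamma (1 - a))⁻¹))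
      (Set.Ioi 0) := by
    by_contra hni
    rw [integral_undef hni] at hI2
    exact (Real.rpow_pos_of_pos hs _).ne hI2
  rw [← hI2, ofReal_integral_eq_lintegral_ofReal hint]
  · simp_rw [ENNReal.ofReal_mul (exp_pos _).le]
  · exact (ae_restrict_mem measurableSet_Ioi).mono fun t ht => by
      have : 0 < t := ht
      positivity

theorem laplace_lintegralK [IsFiniteMeasure ν] (hν : ∀ᵐ a ∂ν, a ∈ Set.Ioo (0:ℝ) 1) {s : ℝ}
    (hs : 0 < s) :
    ∫⁻ t in Set.Ioi (0:ℝ), ENNReal.ofReal (rexp (-(s * t))) * lintegralK ν t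
      = ENNReal.ofReal (mgf id ν (Real.log s) * s⁻¹) := by
  have hm : Measurable fun p : ℝ × ℝ => ENNReal.ofReal (rexp (-(s * p.1))) *
      ENNReal.ofReal (p.1 ^ (-p.2) * (Real.Gamma (1 - p.2))⁻¹) := by
    have h2 : Measurable fun p : ℝ × ℝ => (Real.Gamma (1 - p.2))⁻¹ :=
      continuous_inv_Gamma_one_sub.measurable.comp measurable_snd
    have h3 : Measurable fun p : ℝ × ℝ => ENNReal.ofReal (rexp (-(s * p.1))) := by fun_prop
    exact h3.mul ((measurable_fst.pow measurable_snd.neg).mul h2).ennreal_ofReal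
  calc _ = ∫⁻ t in Set.Ioi (0:ℝ), ∫⁻ a, ENNReal.ofReal (rexp (-(s * t))) *
        ENNReal.ofReal (t ^ (-a) * (Real.Gamma (1 - a))⁻¹) ∂ν := by
        refine lintegral_congr fun t => ?_
        rw [lintegralK, lintegral_const_mul' _ _ ENNReal.ofReal_ne_top]
    _ = ∫⁻ a, (∫⁻ t in Set.Ioi (0:ℝ), ENNReal.ofReal (rexp (-(s * t))) *
        ENNReal.ofReal (t ^ (-a) * (Real.Gamma (1 - a))⁻¹)) ∂ν :=
        lintegral_lintegral_swap hm.aemeasurable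
    _ = ∫⁻ a, ENNReal.ofReal (rexp (Real.log s * a) * s⁻¹) ∂ν := by
        refine lintegral_congr_ae (hν.mono fun a ha => ?_)
        simp only
        rw [lintegral_exp_mul_rpow hs ha.2, Real.rpow_sub_one hs.ne', Real.rpow_def_of_pos hs,
          div_eq_mul_inv]
    _ = _ := by
        rw [← ofReal_integral_eq_lintegral_ofReal (integrable_of_continuous hν (by fun_prop))
          (Eventually.of_forall fun a => by positivity), integral_mul_const]
        rfl

theorem laplace_lintegralL [IsFiniteMeasure ν] [NeZero ν] (hν : ∀ᵐ a ∂ν, a ∈ Set.Ioo (0:ℝ) 1)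
    {s : ℝ} (hs : 0 < s) :
    ∫⁻ t in Set.Ioi (0:ℝ), ENNReal.ofReal (rexp (-(s * t))) * lintegralL ν t
      = ENNReal.ofReal (mgf id ν (Real.log s))⁻¹ := by
  have hH := aemeasurable_ofReal_Hker hν
  have hm : AEMeasurable (Function.uncurry fun t r : ℝ => ENNReal.ofReal (rexp (-(s * t))) *
      (ENNReal.ofReal (rexp (-(r * t))) * ENNReal.ofReal (Hker ν r)))
      ((volume.restrict (Set.Ioi (0:ℝ))).prod (volume.restrict (Set.Ioi (0:ℝ)))) := by
    have h1 : Measurable fun p : ℝ × ℝ => ENNReal.ofReal (rexp (-(s * p.1))) := by fun_prop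
    have h2 : Measurable fun p : ℝ × ℝ => ENNReal.ofReal (rexp (-(p.2 * p.1))) := by fun_prop
    exact h1.aemeasurable.mul (h2.aemeasurable.mul hH.comp_snd)
  have himg : Real.exp '' Set.univ = Set.Ioi 0 := by rw [Set.image_univ, Real.range_exp]
  obtain ⟨hint, hval⟩ := integral_logH hν (Real.log s)
  rw [Real.exp_log hs] at hint hval
  calc _ = ENNReal.ofReal (1 / π) * ∫⁻ t in Set.Ioi (0:ℝ), ∫⁻ r in Set.Ioi (0:ℝ),
        ENNReal.ofReal (rexp (-(s * t))) *
          (ENNReal.ofReal (rexp (-(r * t))) * ENNReal.ofReal (Hker ν r)) := by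
        rw [← lintegral_const_mul' _ _ ENNReal.ofReal_ne_top]
        refine lintegral_congr fun t => ?_
        rw [lintegralL, lintegral_const_mul' _ _ ENNReal.ofReal_ne_top, mul_left_comm]
    _ = ENNReal.ofReal (1 / π) * ∫⁻ r in Set.Ioi (0:ℝ), ∫⁻ t in Set.Ioi (0:ℝ),
        ENNReal.ofReal (rexp (-(s * t))) *
          (ENNReal.ofReal (rexp (-(r * t))) * ENNReal.ofReal (Hker ν r)) := by
        rw [lintegral_lintegral_swap hm]
    _ = ENNReal.ofReal (1 / π) * ∫⁻ r in Set.Ioi (0:ℝ),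
        ENNReal.ofReal (1 / (s + r)) * ENNReal.ofReal (Hker ν r) := by
        congr 1
        refine setLIntegral_congr_fun measurableSet_Ioi fun r hr => ?_
        rw [← lintegral_exp_neg_mul_Ioi (add_pos hs hr),
          ← lintegral_mul_const' _ _ ENNReal.ofReal_ne_top]
        refine lintegral_congr fun t => ?_
        rw [← mul_assoc, ← ENNReal.ofReal_mul (exp_pos _).le, ← Real.exp_add]
        congr 3; ring
    _ = ENNReal.ofReal (1 / π) *
        ∫⁻ x, ENNReal.ofReal (logH ν x * (rexp x / (rexp x + s))) := by
        rw [← himg, lintegral_image_eq_lintegral_abs_deriv_mul MeasurableSet.univ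
          (fun x _ => (Real.hasDerivAt_exp x).hasDerivWithinAt) Real.exp_injective.injOn,
          Measure.restrict_univ]
        congr 1
        refine lintegral_congr fun x => ?_
        rw [abs_of_pos (exp_pos x), Hker_exp hν, ← ENNReal.ofReal_mul (by positivity),
          ← ENNReal.ofReal_mul (by positivity)]
        congr 1
        rw [add_comm s]; ring
    _ = _ := by
        rw [← ofReal_integral_eq_lintegral_ofReal hint (Eventually.of_forall fun x =>
          mul_nonneg (logH_pos hν x).le (by positivity)), hval,
          ← ENNReal.ofReal_mul (by positivity)]
        congr 1
        field_simp

theorem mgf_id_pos [IsFiniteMeasure ν] [NeZero ν] (hν : ∀ᵐ a ∂ν, a ∈ Set.Ioo (0:ℝ) 1) (x : ℝ) :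
    0 < mgf id ν x :=
  integral_exp_pos (integrable_of_continuous hν (by simp only [id]; fun_prop))

theorem lintegralL_setLIntegral_Ioc_lt_top [IsFiniteMeasure ν] [NeZero ν]
    (hν : ∀ᵐ a ∂ν, a ∈ Set.Ioo (0:ℝ) 1) (T : ℝ) :
    ∫⁻ t in Set.Ioc 0 T, lintegralL ν t < ⊤ := by
  calc ∫⁻ t in Set.Ioc 0 T, lintegralL ν t
      ≤ ∫⁻ t in Set.Ioc 0 T, ENNReal.ofReal (rexp T) *
        (ENNReal.ofReal (rexp (-(1 * t))) * lintegralL ν t) := by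
        refine setLIntegral_mono' measurableSet_Ioc fun t ht => ?_
        rw [← mul_assoc, ← ENNReal.ofReal_mul (exp_pos _).le, ← Real.exp_add]
        refine le_mul_of_one_le_left zero_le ?_
        rw [ENNReal.one_le_ofReal]
        exact Real.one_le_exp (by linarith [ht.2])
    _ ≤ ENNReal.ofReal (rexp T) * ∫⁻ t in Set.Ioi 0,
        (ENNReal.ofReal (rexp (-(1 * t))) * lintegralL ν t) := by
        rw [lintegral_const_mul' _ _ ENNReal.ofReal_ne_top]
        gcongr
        exact Set.Ioc_subset_Ioi_self
    _ < ⊤ := by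
        rw [laplace_lintegralL hν one_pos]
        exact ENNReal.mul_lt_top ENNReal.ofReal_lt_top ENNReal.ofReal_lt_top

theorem locallyIntegrableOn_lker [IsFiniteMeasure ν] [NeZero ν]
    (hν : ∀ᵐ a ∂ν, a ∈ Set.Ioo (0:ℝ) 1) : LocallyIntegrableOn (lker ν) (Set.Ici 0) volume := by
  rw [locallyIntegrableOn_iff isClosed_Ici.isLocallyClosed]
  intro k hk hkc
  obtain ⟨T, hT⟩ := hkc.bddAbove
  refine IntegrableOn.mono_set (t := Set.Icc 0 T) ?_ fun x hx => ⟨hk hx, hT hx⟩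
  rw [integrableOn_Icc_iff_integrableOn_Ioc]
  have : lker ν = fun t => (lintegralL ν t).toReal := funext (lker_eq_toReal hν)
  rw [this]
  exact integrable_toReal_of_lintegral_ne_top measurable_lintegralL.aemeasurable
    (lintegralL_setLIntegral_Ioc_lt_top hν T).ne

/-- The convolution of `kker` and `lker` as a lower Lebesgue integral. -/
noncomputable def lintegralConv (ν : Measure ℝ) (t : ℝ) : ℝ≥0∞ :=
  ∫⁻ τ in Set.Ioo 0 t, lintegralK ν (t - τ) * lintegralL ν τ

theorem lintegralConv_eq_indicator (t : ℝ) :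
    lintegralConv ν t = ∫⁻ τ, (Set.Ioi 0).indicator (lintegralK ν) (t - τ) *
      (Set.Ioi 0).indicator (lintegralL ν) τ := by
  rw [lintegralConv, ← lintegral_indicator measurableSet_Ioo]
  refine lintegral_congr fun τ => ?_
  by_cases h1 : 0 < τ <;> by_cases h2 : τ < t <;> simp [Set.indicator, h1, h2]

theorem measurable_lintegralConv [SFinite ν] : Measurable (lintegralConv ν) := by
  have hK := (measurable_lintegralK (ν := ν)).indicator (measurableSet_Ioi (a := (0:ℝ)))
  have hL := (measurable_lintegralL (ν := ν)).indicator (measurableSet_Ioi (a := (0:ℝ)))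
  rw [funext lintegralConv_eq_indicator]
  exact Measurable.lintegral_prod_right'
    (f := fun p : ℝ × ℝ => (Set.Ioi 0).indicator (lintegralK ν) (p.1 - p.2) *
      (Set.Ioi 0).indicator (lintegralL ν) p.2)
    ((hK.comp (measurable_fst.sub measurable_snd)).mul (hL.comp measurable_snd))

theorem laplace_lintegralConv [IsFiniteMeasure ν] [NeZero ν]
    (hν : ∀ᵐ a ∂ν, a ∈ Set.Ioo (0:ℝ) 1) {s : ℝ} (hs : 0 < s) :
    ∫⁻ t in Set.Ioi (0:ℝ), ENNReal.ofReal (rexp (-(s * t))) * lintegralConv ν t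
      = ENNReal.ofReal (1 / s) := by
  set E : ℝ → ℝ≥0∞ := fun t => ENNReal.ofReal (rexp (-(s * t))) with hE
  have hEm : Measurable E := by fun_prop
  have hEadd : ∀ x y, E (x + y) = E x * E y := fun x y => by
    simp only [hE]
    rw [← ENNReal.ofReal_mul (exp_pos _).le, ← Real.exp_add]; congr 2; ring
  set K : ℝ → ℝ≥0∞ := fun x => E x * (Set.Ioi 0).indicator (lintegralK ν) x with hK
  set L : ℝ → ℝ≥0∞ := fun x => E x * (Set.Ioi 0).indicator (lintegralL ν) x with hL
  have hKm : Measurable K := hEm.mul (measurable_lintegralK.indicator measurableSet_Ioi)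
  have hLm : Measurable L := hEm.mul (measurable_lintegralL.indicator measurableSet_Ioi)
  have hind : ∀ f : ℝ → ℝ≥0∞, ∫⁻ x, E x * (Set.Ioi 0).indicator f x
      = ∫⁻ x in Set.Ioi 0, E x * f x := fun f => by
    rw [← lintegral_indicator measurableSet_Ioi]
    refine lintegral_congr fun x => ?_
    by_cases h : 0 < x <;> simp [Set.indicator, h]
  calc _ = ∫⁻ t, E t * lintegralConv ν t := by
        rw [← hind]
        refine lintegral_congr fun t => ?_
        by_cases h : 0 < t
        · simp [Set.indicator, h]
        · simp [Set.indicator, h, lintegralConv]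
    _ = ∫⁻ t, ∫⁻ τ, K (t - τ) * L τ := by
        refine lintegral_congr fun t => ?_
        rw [lintegralConv_eq_indicator, ← lintegral_const_mul' _ _ ENNReal.ofReal_ne_top]
        refine lintegral_congr fun τ => ?_
        have := hEadd (t - τ) τ
        rw [sub_add_cancel] at this
        simp only [hK, hL]
        change E t * _ = _
        rw [this]; ring
    _ = ∫⁻ τ, ∫⁻ t, K (t - τ) * L τ :=
        lintegral_lintegral_swap
          (((hKm.comp (measurable_fst.sub measurable_snd)).mul (hLm.comp measurable_snd)).aemeasurable)
    _ = (∫⁻ x, K x) * ∫⁻ τ, L τ := by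
        rw [← lintegral_const_mul _ hLm]
        refine lintegral_congr fun τ => ?_
        have hm : Measurable fun t => K (t - τ) := hKm.comp (measurable_id.sub_const τ)
        rw [lintegral_mul_const _ hm, lintegral_sub_right_eq_self]
    _ = _ := by
        simp only [hK, hL]
        rw [hind, hind, laplace_lintegralK hν hs, laplace_lintegralL hν hs,
          ← ENNReal.ofReal_mul (mul_nonneg (mgf_id_pos hν _).le (inv_pos.2 hs).le)]
        congr 1
        have := (mgf_id_pos hν (Real.log s)).ne'
        field_simp

theorem lintegralConv_eq_mul {t : ℝ} (ht : 0 < t) :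
    lintegralConv ν t = ENNReal.ofReal t *
      ∫⁻ u in Set.Ioo (0:ℝ) 1, lintegralK ν (t * (1 - u)) * lintegralL ν (t * u) := by
  have himg : (fun u => t * u) '' Set.Ioo 0 1 = Set.Ioo 0 t := by
    rw [Set.image_mul_left_Ioo ht]; simp
  rw [lintegralConv, ← himg, lintegral_image_eq_lintegral_abs_deriv_mul (f' := fun _ => t)
    measurableSet_Ioo (fun x _ => by simpa using ((hasDerivAt_id x).const_mul t).hasDerivWithinAt)
    (mul_right_injective₀ ht.ne').injOn, lintegral_const_mul' _ _ ENNReal.ofReal_ne_top,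
    abs_of_pos ht]
  congr 1
  refine lintegral_congr fun u => ?_
  congr 2; ring

/-- If `G t / t` is antitone and `G = 1` a.e. on the half-line, then `G = 1` everywhere there. -/
theorem eq_one_of_antitoneOn_of_ae_eq_one {G g : ℝ → ℝ≥0∞} (hg : AntitoneOn g (Set.Ioi 0))
    (hGg : ∀ t > 0, G t = ENNReal.ofReal t * g t)
    (hG : ∀ᵐ t ∂(volume.restrict (Set.Ioi (0:ℝ))), G t = 1) {t : ℝ} (ht : 0 < t) : G t = 1 := by
  have hex : ∀ a b : ℝ, 0 ≤ a → a < b → ∃ c ∈ Set.Ioo a b, G c = 1 := by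
    intro a b ha hab
    have h1 := ae_restrict_of_ae_restrict_of_subset
      (fun x (hx : x ∈ Set.Ioo a b) => (Set.mem_Ioi.2 (ha.trans_lt hx.1))) hG
    have : NeBot (ae (volume.restrict (Set.Ioo a b))) := by
      rw [ae_neBot, Ne, Measure.restrict_eq_zero]
      simp [hab]
    obtain ⟨c, hc, hcm⟩ := (h1.and (ae_restrict_mem measurableSet_Ioo)).exists
    exact ⟨c, hcm, hc⟩
  have hscale : ∀ c > 0, G c = 1 → ENNReal.ofReal t * g c = ENNReal.ofReal (t / c) := by
    intro c hc h
    have h2 : ENNReal.ofReal t = ENNReal.ofReal (t / c) * ENNReal.ofReal c := by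
      rw [← ENNReal.ofReal_mul (by positivity), div_mul_cancel₀ _ hc.ne']
    rw [h2, mul_assoc, ← hGg c hc, h, mul_one]
  have hlim : Tendsto (fun c : ℝ => ENNReal.ofReal (t / c)) (𝓝 t) (𝓝 1) := by
    have : ContinuousAt (fun c : ℝ => t / c) t := continuousAt_const.div continuousAt_id ht.ne'
    have h2 := ENNReal.tendsto_ofReal this.tendsto
    simpa [div_self ht.ne'] using h2
  refine le_antisymm ?_ ?_
  · refine ge_of_tendsto (hlim.mono_left nhdsWithin_le_nhds : Tendsto _ (𝓝[<] t) _) ?_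
    filter_upwards [Ioo_mem_nhdsLT ht] with a ha
    obtain ⟨c, hc, hGc⟩ := hex a t ha.1.le ha.2
    have hc0 : 0 < c := ha.1.trans hc.1
    rw [hGg t ht]
    calc _ ≤ ENNReal.ofReal t * g c := by gcongr; exact hg hc0 ht hc.2.le
      _ = ENNReal.ofReal (t / c) := hscale c hc0 hGc
      _ ≤ _ := ENNReal.ofReal_le_ofReal
          (div_le_div_of_nonneg_left ht.le ha.1 hc.1.le)
  · refine le_of_tendsto (hlim.mono_left nhdsWithin_le_nhds : Tendsto _ (𝓝[>] t) _) ?_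
    filter_upwards [self_mem_nhdsWithin] with b hb
    obtain ⟨c, hc, hGc⟩ := hex t b ht.le hb
    have hc0 : 0 < c := ht.trans hc.1
    rw [hGg t ht]
    calc _ ≤ ENNReal.ofReal (t / c) := ENNReal.ofReal_le_ofReal
          (div_le_div_of_nonneg_left ht.le hc0 hc.2.le)
      _ = ENNReal.ofReal t * g c := (hscale c hc0 hGc).symm
      _ ≤ _ := by gcongr; exact hg ht hc0 hc.1.le

theorem lintegralConv_eq_one [IsFiniteMeasure ν] [NeZero ν] (hν : ∀ᵐ a ∂ν, a ∈ Set.Ioo (0:ℝ) 1)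
    {t : ℝ} (ht : 0 < t) : lintegralConv ν t = 1 := by
  refine eq_one_of_antitoneOn_of_ae_eq_one ?_ (fun t ht => lintegralConv_eq_mul ht)
    (ae_eq_one_of_laplace_eq measurable_lintegralConv fun s hs => laplace_lintegralConv hν hs) ht
  intro x hx y hy hxy
  refine setLIntegral_mono' measurableSet_Ioo fun u hu => ?_
  have hx0 : 0 < x := hx
  have hy0 : 0 < y := hy
  have hu1 : 0 < 1 - u := by linarith [hu.2]
  exact mul_le_mul'
    (antitoneOn_lintegralK hν (mul_pos hx0 hu1) (mul_pos hy0 hu1) (by gcongr))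
    (antitone_lintegralL (mul_le_mul_of_nonneg_right hxy hu.1.le))

theorem integral_kker_mul_lker [IsFiniteMeasure ν] [NeZero ν]
    (hν : ∀ᵐ a ∂ν, a ∈ Set.Ioo (0:ℝ) 1) {t : ℝ} (ht : 0 < t) :
    ∫ τ in (0:ℝ)..t, kker ν (t - τ) * lker ν τ = 1 := by
  have hone := lintegralConv_eq_one hν ht
  rw [lintegralConv] at hone
  have hm : Measurable fun τ => lintegralK ν (t - τ) * lintegralL ν τ :=
    (measurable_lintegralK.comp (measurable_const.sub measurable_id)).mul measurable_lintegralL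
  rw [intervalIntegral.integral_of_le ht.le, integral_Ioc_eq_integral_Ioo]
  calc _ = ∫ τ in Set.Ioo 0 t, (lintegralK ν (t - τ) * lintegralL ν τ).toReal :=
        setIntegral_congr_fun measurableSet_Ioo fun τ hτ => by
          rw [kker_eq_toReal hν (sub_pos.2 hτ.2), lker_eq_toReal hν, ENNReal.toReal_mul]
    _ = 1 := by
        rw [integral_toReal hm.aemeasurable (ae_lt_top hm (by rw [hone]; simp)), hone,
          ENNReal.toReal_one]

end UnitInterval

theorem IsDistOrderMeasure.ae_mem_Ioo {μ : Measure ℝ} (hμ : IsDistOrderMeasure μ) :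
    ∀ᵐ a ∂μ, a ∈ Set.Ioo (0:ℝ) 1 := by
  obtain ⟨-, M, α, q, w, -, hα, -, -, -, rfl⟩ := hμ
  rw [ae_iff, Measure.add_apply, add_eq_zero]
  constructor
  · rw [Measure.finsetSum_apply]
    refine Finset.sum_eq_zero fun n _ => ?_
    have : α n ∉ {a | a ∉ Set.Ioo (0:ℝ) 1} := fun h => h (hα n)
    have hm : MeasurableSet {a | a ∉ Set.Ioo (0:ℝ) 1} := measurableSet_Ioo.compl
    rw [Measure.smul_apply, Measure.dirac_apply' _ hm,
      Set.indicator_of_notMem this,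
      smul_zero]
  · exact withDensity_absolutelyContinuous _ _ (ae_iff.1 (ae_restrict_mem measurableSet_Ioo))

/-- The function `l` is nonnegative on `(0,∞)`, locally integrable on `[0,∞)`, and satisfies
`(k ∗ l)(t) = ∫₀ᵗ k(t−τ) l(τ) dτ = 1` for every `t > 0`. -/
theorem statement2 (μ : Measure ℝ) [IsFiniteMeasure μ] (hμ : IsDistOrderMeasure μ) :
    (∀ t > (0:ℝ), 0 ≤ lker μ t) ∧
    LocallyIntegrableOn (lker μ) (Set.Ici 0) volume ∧
    ∀ t > (0:ℝ), ∫ τ in (0:ℝ)..t, kker μ (t - τ) * lker μ τ = 1 := by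
  have : NeZero μ := ⟨hμ.1⟩
  have hν := hμ.ae_mem_Ioo
  exact ⟨fun t _ => lker_nonneg hν t, locallyIntegrableOn_lker hν,
    fun t ht => integral_kker_mul_lker hν ht⟩
end

section
/- For every T > 0 there exists a constant c = c(μ,T) > 0 such that for every t ∈ (0,T] one has the lower bound l(t) ≥ c / ∫_{(0,1]} t^{1−α} dμ(α). -/
open MeasureTheory Real

open Filter Topology Set

/-- The difference quotient of `h` at `σ` in the variable `exp ζ`, times `exp ζ`. -/
noncomputable def expQuotient (h : ℂ → ℂ) (σ ζ : ℂ) : ℂ :=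
  Complex.exp ζ * (dslope h σ ζ / dslope Complex.exp σ ζ)

theorem expQuotient_of_ne (h : ℂ → ℂ) {σ ζ : ℂ} (hne : ζ ≠ σ) :
    expQuotient h σ ζ =
      Complex.exp ζ * ((h ζ - h σ) / (Complex.exp ζ - Complex.exp σ)) := by
  have : ζ - σ ≠ 0 := sub_ne_zero.mpr hne
  rw [expQuotient, dslope_of_ne _ hne, dslope_of_ne _ hne, slope_def_field, slope_def_field,
    div_div_div_cancel_right₀ this]

theorem dslope_exp_ne_zero_s4 (σ : ℝ) {ζ : ℂ} (h0 : 0 ≤ ζ.im) (hπ : ζ.im ≤ π) :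
    dslope Complex.exp σ ζ ≠ 0 := by
  by_cases hne : ζ = σ
  · subst hne
    simp [dslope_same]
  · rw [dslope_of_ne _ hne, slope_def_field]
    refine div_ne_zero (fun heq => hne ?_) (sub_ne_zero.mpr hne)
    obtain ⟨n, hn⟩ := Complex.exp_eq_exp_iff_exists_int.mp (sub_eq_zero.mp heq)
    have him : ζ.im = n * (2 * π) := by
      have := congrArg Complex.im hn
      simpa using this
    have h1 : (n : ℝ) < 1 := by nlinarith [pi_pos]
    have h2 : (-1 : ℝ) < n := by nlinarith [pi_pos]
    have : n = 0 := by
      have h1' : n < 1 := by exact_mod_cast h1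
      have h2' : -1 < n := by exact_mod_cast h2
      omega
    simpa [this] using hn

theorem continuousAt_expQuotient {h : ℂ → ℂ} (hd : ∀ ζ : ℂ, 0 ≤ ζ.im → ζ.im ≤ π →
    DifferentiableAt ℂ h ζ) (σ : ℝ) {ζ : ℂ} (h0 : 0 ≤ ζ.im) (hπ : ζ.im ≤ π) :
    ContinuousAt (expQuotient h σ) ζ := by
  refine Complex.continuous_exp.continuousAt.mul
    (ContinuousAt.div ?_ ?_ (dslope_exp_ne_zero_s4 σ h0 hπ))
  · by_cases hne : ζ = σ
    · subst hne
      exact continuousAt_dslope_same.2 (hd _ h0 hπ)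
    · exact (continuousAt_dslope_of_ne hne).2 (hd _ h0 hπ).continuousAt
  · by_cases hne : ζ = σ
    · subst hne
      exact continuousAt_dslope_same.2 Complex.differentiableAt_exp
    · exact (continuousAt_dslope_of_ne hne).2 Complex.continuous_exp.continuousAt

theorem differentiableAt_expQuotient {h : ℂ → ℂ} (hd : ∀ ζ : ℂ, 0 ≤ ζ.im → ζ.im ≤ π →
    DifferentiableAt ℂ h ζ) (σ : ℝ) {ζ : ℂ} (h0 : 0 < ζ.im) (hπ : ζ.im ≤ π) :
    DifferentiableAt ℂ (expQuotient h σ) ζ := by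
  have hne : ζ ≠ σ := by
    rintro rfl
    simp at h0
  exact Complex.differentiableAt_exp.mul
    (((differentiableAt_dslope_of_ne hne).2 (hd _ h0.le hπ)).div
      ((differentiableAt_dslope_of_ne hne).2 Complex.differentiableAt_exp)
      (dslope_exp_ne_zero_s4 σ h0.le hπ))

/-- Cauchy's theorem on the rectangle `[a, b] × [0, π]` for `expQuotient h σ`. -/
theorem intervalIntegral_stieltjes {h : ℂ → ℂ} (hd : ∀ ζ : ℂ, 0 ≤ ζ.im → ζ.im ≤ π →
    DifferentiableAt ℂ h ζ) (hreal : ∀ x : ℝ, (h x).im = 0) (σ a b : ℝ) :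
    ∫ x in a..b, rexp x * -(h (x + π * Complex.I)).im / (rexp x + rexp σ) =
      (∫ y in (0:ℝ)..π, expQuotient h σ (a + y * Complex.I)).re -
      (∫ y in (0:ℝ)..π, expQuotient h σ (b + y * Complex.I)).re := by
  have hcauchy := Complex.integral_boundary_rect_eq_zero_of_continuousOn_of_differentiableOn
    (expQuotient h σ) (a : ℂ) (b + π * Complex.I) ?_ ?_
  · simp only [Complex.ofReal_re, Complex.ofReal_im, Complex.add_re, Complex.mul_re,
      Complex.I_re, mul_zero, Complex.I_im, mul_one, Complex.add_im, Complex.mul_im,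
      add_zero, zero_add, Complex.ofReal_zero, zero_mul, sub_self] at hcauchy
    have him := congrArg Complex.im hcauchy
    have hint : ∀ y : ℝ, 0 ≤ y → y ≤ π →
        IntervalIntegrable (fun x : ℝ => expQuotient h σ (x + y * Complex.I)) volume a b := by
      intro y h0 hπ
      refine Continuous.intervalIntegrable (continuous_iff_continuousAt.mpr fun x => ?_) _ _
      have := continuousAt_expQuotient hd σ (ζ := (x : ℂ) + y * Complex.I) (by simpa) (by simpa)
      exact ContinuousAt.comp (f := fun x : ℝ => (x : ℂ) + y * Complex.I) this (by fun_prop)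
    have hbot : (∫ x in a..b, expQuotient h σ (x : ℂ)).im = 0 := by
      have h1 := hint 0 le_rfl pi_pos.le
      simp only [Complex.ofReal_zero, zero_mul, add_zero] at h1
      rw [← Complex.imCLM_apply, ← ContinuousLinearMap.intervalIntegral_comp_comm _ h1]
      rw [intervalIntegral.integral_zero_ae]
      have : ∀ᵐ x : ℝ, x ≠ σ := by simp [ae_iff]
      filter_upwards [this] with x hx _
      have hne : (x : ℂ) ≠ σ := by exact_mod_cast hx
      rw [Complex.imCLM_apply, expQuotient_of_ne _ hne]
      have e1 : h x = ((h x).re : ℂ) := Complex.ext rfl (by simp [hreal])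
      have e2 : h σ = ((h σ).re : ℂ) := Complex.ext rfl (by simp [hreal])
      rw [e1, e2, ← Complex.ofReal_exp, ← Complex.ofReal_exp, ← Complex.ofReal_sub,
        ← Complex.ofReal_sub, ← Complex.ofReal_div, ← Complex.ofReal_mul, Complex.ofReal_im]
    have htop : (∫ x in a..b, expQuotient h σ (x + π * Complex.I)).im =
        -∫ x in a..b, rexp x * -(h (x + π * Complex.I)).im / (rexp x + rexp σ) := by
      rw [← Complex.imCLM_apply,
        ← ContinuousLinearMap.intervalIntegral_comp_comm _ (hint π pi_pos.le le_rfl),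
        ← intervalIntegral.integral_neg]
      refine intervalIntegral.integral_congr fun x _ => ?_
      have hne : (x : ℂ) + π * Complex.I ≠ σ := fun heq => by
        have := congrArg Complex.im heq
        simp [pi_ne_zero] at this
      simp only [Complex.imCLM_apply]
      rw [expQuotient_of_ne _ hne, Complex.exp_add, Complex.exp_pi_mul_I]
      have e2 : h σ = ((h σ).re : ℂ) := Complex.ext rfl (by simp [hreal])
      have hpos : (rexp x + rexp σ) ≠ 0 := by positivity
      have e3 : Complex.exp x * -1 * ((h (x + π * Complex.I) - h σ) /
          (Complex.exp x * -1 - Complex.exp σ)) =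
          ((rexp x / (rexp x + rexp σ) : ℝ) : ℂ) * (h (x + π * Complex.I) - ((h σ).re : ℂ)) := by
        rw [← e2]
        have : Complex.exp x + Complex.exp σ ≠ 0 := by
          exact_mod_cast hpos
        rw [show Complex.exp x * -1 - Complex.exp σ = -(Complex.exp x + Complex.exp σ) by ring]
        push_cast
        field_simp
      rw [e3, Complex.im_ofReal_mul, Complex.sub_im, Complex.ofReal_im]
      ring
    simp only [Complex.sub_im, Complex.add_im, hbot, htop, smul_eq_mul, Complex.mul_im,
      Complex.I_re, Complex.I_im, zero_mul, one_mul, zero_add, Complex.zero_im] at him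
    linarith
  · intro ζ hζ
    have hζ' := hζ.2
    simp only [Complex.ofReal_im, Complex.add_im, Complex.mul_im, Complex.ofReal_re,
      Complex.I_im, mul_one, Complex.I_re, mul_zero, add_zero, zero_add, mem_preimage,
      uIcc_of_le pi_pos.le, mem_Icc] at hζ'
    exact (continuousAt_expQuotient hd σ hζ'.1 hζ'.2).continuousWithinAt
  · intro ζ hζ
    have hζ' := hζ.2
    simp only [Complex.ofReal_im, Complex.add_im, Complex.mul_im, Complex.ofReal_re,
      Complex.I_im, mul_one, Complex.I_re, mul_zero, add_zero, zero_add, mem_preimage,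
      min_eq_left pi_pos.le, max_eq_right pi_pos.le, mem_Ioo] at hζ'
    exact (differentiableAt_expQuotient hd σ hζ'.1 hζ'.2.le).differentiableWithinAt

theorem tendsto_intervalIntegral_of_norm_sub_le {l : Filter ℝ} {F : ℝ → ℝ → ℂ} {L : ℂ}
    {D : ℝ → ℝ} {c : ℝ} (hc : 0 ≤ c) (hF : ∀ x, ContinuousOn (F x) (Icc 0 c))
    (hD : Tendsto D l (𝓝 0)) (hle : ∀ᶠ x in l, ∀ y ∈ Icc 0 c, ‖F x y - L‖ ≤ D x) :
    Tendsto (fun x => ∫ y in (0:ℝ)..c, F x y) l (𝓝 (c * L)) := by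
  rw [tendsto_iff_norm_sub_tendsto_zero]
  have hDc : Tendsto (fun x => D x * |c - 0|) l (𝓝 0) := by simpa using hD.mul_const |c - 0|
  refine squeeze_zero' (Eventually.of_forall fun _ => norm_nonneg _) ?_ hDc
  filter_upwards [hle] with x hx
  have hint : IntervalIntegrable (F x) volume 0 c :=
    ContinuousOn.intervalIntegrable (by simpa [uIcc_of_le hc] using hF x)
  have : (∫ y in (0:ℝ)..c, F x y) - c * L = ∫ y in (0:ℝ)..c, (F x y - L) := by
    rw [intervalIntegral.integral_sub hint (by simp)]
    simp
  rw [this]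
  refine intervalIntegral.norm_integral_le_of_norm_le_const fun y hy => hx y ?_
  rw [uIoc_of_le hc] at hy
  exact Ioc_subset_Icc_self hy

/-- If `h` is holomorphic on the closed strip `0 ≤ Im ζ ≤ π`, real on the real axis and decays
suitably at both ends, then `h` on the real axis is the Stieltjes transform of its imaginary part
on the line `Im ζ = π` (in the variable `exp ζ`). -/
theorem integrable_and_integral_stieltjes {h : ℂ → ℂ} (hd : ∀ ζ : ℂ, 0 ≤ ζ.im → ζ.im ≤ π →
    DifferentiableAt ℂ h ζ) (hreal : ∀ x : ℝ, (h x).im = 0)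
    (him : ∀ x : ℝ, (h (x + π * Complex.I)).im ≤ 0) {B : ℝ → ℝ}
    (hB : ∀ ζ : ℂ, 0 ≤ ζ.im → ζ.im ≤ π → ‖h ζ‖ ≤ B ζ.re)
    (hbot : Tendsto (fun x => rexp x * B x) atBot (𝓝 0)) (htop : Tendsto B atTop (𝓝 0))
    (σ : ℝ) :
    Integrable (fun x : ℝ => rexp x * -(h (x + π * Complex.I)).im / (rexp x + rexp σ)) ∧
      ∫ x : ℝ, rexp x * -(h (x + π * Complex.I)).im / (rexp x + rexp σ) = π * (h σ).re := by
  have hcont : ∀ x : ℝ, ContinuousOn (fun y : ℝ => expQuotient h σ (x + y * Complex.I))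
      (Icc 0 π) := fun x y hy => by
    have := continuousAt_expQuotient hd σ (ζ := (x : ℂ) + y * Complex.I)
      (by simpa using hy.1) (by simpa using hy.2)
    exact (ContinuousAt.comp (f := fun y : ℝ => (x : ℂ) + y * Complex.I) this
      (by fun_prop)).continuousWithinAt
  have hexp : ∀ x y : ℝ, ‖Complex.exp (x + y * Complex.I)‖ = rexp x := fun x y => by
    simp [Complex.norm_exp]
  have hsub : ∀ x y : ℝ, |rexp x - rexp σ| ≤
      ‖Complex.exp (x + y * Complex.I) - Complex.exp σ‖ := fun x y => by
    have := abs_norm_sub_norm_le (Complex.exp (x + y * Complex.I)) (Complex.exp σ)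
    rwa [hexp, Complex.norm_exp, Complex.ofReal_re] at this
  have hne : ∀ x y : ℝ, x ≠ σ → (x : ℂ) + y * Complex.I ≠ σ := fun x y hx heq =>
    hx (by simpa using congrArg Complex.re heq)
  have hlimbot : Tendsto (fun x : ℝ => ∫ y in (0:ℝ)..π, expQuotient h σ (x + y * Complex.I))
      atBot (𝓝 (π * 0)) := by
    have hD : Tendsto (fun x => (rexp x * B x + rexp x * ‖h σ‖) / (rexp σ - rexp x)) atBot
        (𝓝 ((0 + 0 * ‖h σ‖) / (rexp σ - 0))) :=
      (hbot.add (tendsto_exp_atBot.mul_const _)).div (tendsto_exp_atBot.const_sub _)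
        (by simp [exp_ne_zero])
    rw [zero_mul, add_zero, zero_div] at hD
    refine tendsto_intervalIntegral_of_norm_sub_le pi_pos.le hcont hD ?_
    filter_upwards [eventually_lt_atBot σ] with x hx y hy
    have hlt : 0 < rexp σ - rexp x := sub_pos.mpr (exp_lt_exp.mpr hx)
    rw [sub_zero, expQuotient_of_ne _ (hne x y hx.ne), norm_mul, norm_div, hexp, ← mul_add,
      mul_div_assoc]
    have h1 := hsub x y
    rw [abs_sub_comm, abs_of_pos hlt] at h1
    have h2 := hB (x + y * Complex.I) (by simpa using hy.1) (by simpa using hy.2)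
    have h3 := (norm_sub_le (h (x + y * Complex.I)) (h σ)).trans (add_le_add_left h2 _)
    simp only [Complex.add_re, Complex.ofReal_re, Complex.mul_re, Complex.I_re, mul_zero,
      Complex.ofReal_im, Complex.I_im, mul_one, sub_self, add_zero] at h3
    gcongr
    exact (norm_nonneg _).trans h3
  have hlimtop : Tendsto (fun x : ℝ => ∫ y in (0:ℝ)..π, expQuotient h σ (x + y * Complex.I))
      atTop (𝓝 (π * -h σ)) := by
    have hE : Tendsto (fun x => rexp (-x)) atTop (𝓝 0) :=
      tendsto_exp_neg_atTop_nhds_zero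
    have hD : Tendsto (fun x => (B x + rexp (-x) * (rexp σ * ‖h σ‖)) / (1 - rexp (-x) * rexp σ))
        atTop (𝓝 ((0 + 0 * (rexp σ * ‖h σ‖)) / (1 - 0 * rexp σ))) :=
      (htop.add (hE.mul_const _)).div ((hE.mul_const _).const_sub _) (by simp)
    simp only [zero_mul, add_zero, zero_div] at hD
    refine tendsto_intervalIntegral_of_norm_sub_le pi_pos.le hcont hD ?_
    filter_upwards [eventually_gt_atTop σ] with x hx y hy
    have hlt : 0 < rexp x - rexp σ := sub_pos.mpr (exp_lt_exp.mpr hx)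
    have h1 := hsub x y
    rw [abs_of_pos hlt] at h1
    have h2 := hB (x + y * Complex.I) (by simpa using hy.1) (by simpa using hy.2)
    simp only [Complex.add_re, Complex.ofReal_re, Complex.mul_re, Complex.I_re, mul_zero,
      Complex.ofReal_im, Complex.I_im, mul_one, sub_self, add_zero] at h2
    have hden : Complex.exp (x + y * Complex.I) - Complex.exp σ ≠ 0 :=
      norm_pos_iff.mp (hlt.trans_le h1)
    have e1 : expQuotient h σ (x + y * Complex.I) - -h σ =
        (Complex.exp (x + y * Complex.I) * h (x + y * Complex.I) - Complex.exp σ * h σ) /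
          (Complex.exp (x + y * Complex.I) - Complex.exp σ) := by
      rw [expQuotient_of_ne _ (hne x y hx.ne')]
      field_simp
      ring
    have e2 : (B x + rexp (-x) * (rexp σ * ‖h σ‖)) / (1 - rexp (-x) * rexp σ) =
        (rexp x * B x + rexp σ * ‖h σ‖) / (rexp x - rexp σ) := by
      have hcancel : rexp x * rexp (-x) = 1 := by rw [← exp_add, add_neg_cancel, exp_zero]
      rw [← mul_div_mul_left _ _ (exp_ne_zero x)]
      congr 1
      · linear_combination (rexp σ * ‖h σ‖) * hcancel
      · linear_combination -rexp σ * hcancel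
    have h3 := norm_sub_le (Complex.exp (x + y * Complex.I) * h (x + y * Complex.I))
      (Complex.exp σ * h σ)
    rw [norm_mul, norm_mul, hexp, Complex.norm_exp, Complex.ofReal_re] at h3
    have h4 : rexp x * ‖h (x + y * Complex.I)‖ ≤ rexp x * B x := by gcongr
    rw [e1, e2, norm_div]
    have h5 := h3.trans (add_le_add_left h4 _)
    gcongr
    exact (norm_nonneg _).trans h5
  set G : ℝ → ℝ := fun x => rexp x * -(h (x + π * Complex.I)).im / (rexp x + rexp σ) with hG
  have hGnonneg : ∀ x, 0 ≤ G x := fun x =>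
    div_nonneg (mul_nonneg (exp_pos x).le (neg_nonneg.mpr (him x))) (by positivity)
  have hGcont : Continuous G := by
    have : Continuous fun x : ℝ => h (x + π * Complex.I) :=
      continuous_iff_continuousAt.mpr fun x => ContinuousAt.comp (g := h)
        (f := fun x : ℝ => (x : ℂ) + π * Complex.I)
        (hd _ (by simpa using pi_pos.le) (by simp)).continuousAt (by fun_prop)
    refine (continuous_exp.mul (Complex.continuous_im.comp this).neg).div
      (by fun_prop) fun x => by positivity
  have hlim : Tendsto (fun x : ℝ => ∫ u in (-x)..x, G u) atTop (𝓝 (π * (h σ).re)) := by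
    have h1 := (Complex.continuous_re.tendsto _).comp (hlimbot.comp tendsto_neg_atTop_atBot)
    have h2 := (Complex.continuous_re.tendsto _).comp hlimtop
    have h3 := h1.sub h2
    have e : (π * 0 : ℂ).re - (π * -h σ : ℂ).re = π * (h σ).re := by simp
    rw [e] at h3
    refine h3.congr fun x => ?_
    rw [hG, intervalIntegral_stieltjes hd hreal]
    rfl
  have hint : Integrable G := by
    refine integrable_of_intervalIntegral_norm_tendsto (π * (h σ).re)
      (fun x => (hGcont.integrableOn_Icc).mono_set Ioc_subset_Icc_self)
      tendsto_neg_atTop_atBot tendsto_id ?_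
    simpa only [Real.norm_of_nonneg (hGnonneg _), id_eq] using hlim
  exact ⟨hint, tendsto_nhds_unique
    (intervalIntegral_tendsto_integral hint tendsto_neg_atTop_atBot tendsto_id) hlim⟩

open ProbabilityTheory

section UnitSupport

variable {ν : Measure ℝ} [IsFiniteMeasure ν]

theorem integrable_exp_mul_of_ae_mem_Icc (hν : ∀ᵐ a ∂ν, a ∈ Icc (0:ℝ) 1) (x : ℝ) :
    Integrable (fun a => rexp (x * a)) ν :=
  integrable_exp_mul_of_mem_Icc (X := id) aemeasurable_id hν

theorem differentiable_complexMGF_id_s4 (hν : ∀ᵐ a ∂ν, a ∈ Icc (0:ℝ) 1) (ζ : ℂ) :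
    DifferentiableAt ℂ (complexMGF id ν) ζ := by
  have : integrableExpSet id ν = univ :=
    eq_univ_of_forall fun x => integrable_exp_mul_of_ae_mem_Icc hν x
  exact (hasDerivAt_complexMGF (by simp [this])).differentiableAt

theorem integrable_cexp_mul (hν : ∀ᵐ a ∂ν, a ∈ Icc (0:ℝ) 1) (ζ : ℂ) :
    Integrable (fun a : ℝ => Complex.exp (ζ * a)) ν := by
  refine (integrable_exp_mul_of_ae_mem_Icc hν ζ.re).mono' (by fun_prop) ?_
  exact Eventually.of_forall fun a => by simp [Complex.norm_exp]

/-- On the strip `0 ≤ Im ζ ≤ π` the values `exp (ζ a)`, `a ∈ [0, 1]`, lie in a half-plane, hence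
no cancellation occurs in `∫ exp (ζ a) dν(a)`. -/
theorem le_norm_complexMGF_id (hν : ∀ᵐ a ∂ν, a ∈ Icc (0:ℝ) 1) {ε : ℝ} (hε0 : 0 < ε)
    (hε : ε ≤ 1 / 2) {ζ : ℂ} (h0 : 0 ≤ ζ.im) (hπ : ζ.im ≤ π) :
    cos ((1 / 2 - ε) * π) * ν.real (Icc ε (1 - ε)) *
      rexp (ζ.re / 2 - (1 / 2 - ε) * |ζ.re|) ≤ ‖complexMGF id ν ζ‖ := by
  set u : ℂ := Complex.exp (-(ζ.im / 2 : ℝ) * Complex.I) with hu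
  have hnorm : ‖u‖ = 1 := by
    rw [hu, ← Complex.ofReal_neg, Complex.norm_exp_ofReal_mul_I]
  have hre : (complexMGF id ν ζ * u).re = ∫ a, rexp (ζ.re * a) * cos (ζ.im * (a - 1 / 2)) ∂ν := by
    rw [complexMGF, ← integral_mul_const]
    have := integral_re ((integrable_cexp_mul hν ζ).mul_const u)
    simp only [id_eq, RCLike.re_to_complex] at this ⊢
    rw [← this]
    refine integral_congr_ae (Eventually.of_forall fun a => ?_)
    simp only [hu, ← Complex.exp_add, Complex.exp_re]
    congr 2
    · simp
    · simp
      ring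
  have hint : Integrable (fun a => rexp (ζ.re * a) * cos (ζ.im * (a - 1 / 2))) ν := by
    refine (integrable_exp_mul_of_ae_mem_Icc hν ζ.re).mono' (by fun_prop) ?_
    refine Eventually.of_forall fun a => ?_
    rw [norm_mul, Real.norm_of_nonneg (exp_pos _).le, Real.norm_eq_abs]
    exact mul_le_of_le_one_right (exp_pos _).le (abs_cos_le_one _)
  have hcos : ∀ δ, 0 ≤ δ → δ ≤ 1 / 2 → ∀ a : ℝ, |a - 1 / 2| ≤ δ →
      cos (δ * π) ≤ cos (ζ.im * (a - 1 / 2)) := fun δ hδ0 hδ a ha => by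
    rw [← cos_abs (ζ.im * _), abs_mul, abs_of_nonneg h0, mul_comm]
    refine cos_le_cos_of_nonneg_of_le_pi (by positivity) (by nlinarith [pi_pos]) ?_
    gcongr
  calc
    _ = ∫ _ in Icc ε (1 - ε), cos ((1 / 2 - ε) * π) *
          rexp (ζ.re / 2 - (1 / 2 - ε) * |ζ.re|) ∂ν := by
      rw [setIntegral_const, smul_eq_mul]
      ring
    _ ≤ ∫ a in Icc ε (1 - ε), rexp (ζ.re * a) * cos (ζ.im * (a - 1 / 2)) ∂ν := by
      refine setIntegral_mono_on integrableOn_const hint.integrableOn measurableSet_Icc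
        fun a ha => ?_
      have ha' : |a - 1 / 2| ≤ 1 / 2 - ε := abs_le.mpr ⟨by linarith [ha.1], by linarith [ha.2]⟩
      have hc := hcos _ (by linarith) (by linarith) a ha'
      have hc0 : 0 ≤ cos ((1 / 2 - ε) * π) :=
        cos_nonneg_of_neg_pi_div_two_le_of_le (by nlinarith [pi_pos]) (by nlinarith [pi_pos])
      rw [mul_comm]
      have he : ζ.re / 2 - (1 / 2 - ε) * |ζ.re| ≤ ζ.re * a := by
        have h1 : |ζ.re * (a - 1 / 2)| ≤ (1 / 2 - ε) * |ζ.re| := by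
          rw [abs_mul, mul_comm]
          gcongr
        linarith [(abs_le.mp h1).1]
      gcongr
    _ ≤ ∫ a, rexp (ζ.re * a) * cos (ζ.im * (a - 1 / 2)) ∂ν := by
      refine setIntegral_le_integral hint ?_
      filter_upwards [hν] with a ha
      have := hcos (1 / 2) (by norm_num) le_rfl a
        (abs_le.mpr ⟨by linarith [ha.1], by linarith [ha.2]⟩)
      rw [one_div, inv_mul_eq_div, cos_pi_div_two] at this
      exact mul_nonneg (exp_pos _).le (by simpa using this)
    _ = (complexMGF id ν ζ * u).re := hre.symm
    _ ≤ ‖complexMGF id ν ζ * u‖ := Complex.re_le_norm _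
    _ = ‖complexMGF id ν ζ‖ := by rw [norm_mul, hnorm, mul_one]

/-- The Stieltjes representation of `1 / ∫ sᵃ dν(a)`, written in the variables
`x = log r`, `σ = log s`. -/
theorem integrable_and_integral_inv_complexMGF_id (hν : ∀ᵐ a ∂ν, a ∈ Icc (0:ℝ) 1) {ε : ℝ}
    (hε0 : 0 < ε) (hε : ε ≤ 1 / 2) (hmass : 0 < ν.real (Icc ε (1 - ε))) (σ : ℝ) :
    Integrable (fun x : ℝ =>
        rexp x * -((complexMGF id ν (x + π * Complex.I))⁻¹).im / (rexp x + rexp σ)) ∧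
      ∫ x : ℝ, rexp x * -((complexMGF id ν (x + π * Complex.I))⁻¹).im / (rexp x + rexp σ) =
        π * (mgf id ν σ)⁻¹ := by
  set κ := cos ((1 / 2 - ε) * π) * ν.real (Icc ε (1 - ε)) with hκ
  have hκ0 : 0 < κ := mul_pos
    (cos_pos_of_mem_Ioo ⟨by nlinarith [pi_pos], by nlinarith [pi_pos]⟩) hmass
  have hlow : ∀ ζ : ℂ, 0 ≤ ζ.im → ζ.im ≤ π →
      κ * rexp (ζ.re / 2 - (1 / 2 - ε) * |ζ.re|) ≤ ‖complexMGF id ν ζ‖ :=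
    fun ζ h0 hπ => le_norm_complexMGF_id hν hε0 hε h0 hπ
  have hne : ∀ ζ : ℂ, 0 ≤ ζ.im → ζ.im ≤ π → complexMGF id ν ζ ≠ 0 := fun ζ h0 hπ =>
    norm_pos_iff.mp ((by positivity : 0 < κ * _).trans_le (hlow ζ h0 hπ))
  have hkey := integrable_and_integral_stieltjes (h := fun ζ => (complexMGF id ν ζ)⁻¹)
    (B := fun x => κ⁻¹ * rexp (-(x / 2 - (1 / 2 - ε) * |x|)))
    (fun ζ h0 hπ => (differentiable_complexMGF_id_s4 hν ζ).inv (hne ζ h0 hπ))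
    (fun x => by rw [complexMGF_ofReal, ← Complex.ofReal_inv, Complex.ofReal_im])
    (fun x => ?_) (fun ζ h0 hπ => ?_) ?_ ?_ σ
  · simpa only [complexMGF_ofReal, ← Complex.ofReal_inv, Complex.ofReal_re] using hkey
  · rw [Complex.inv_im]
    refine div_nonpos_of_nonpos_of_nonneg (neg_nonpos.mpr ?_) (Complex.normSq_nonneg _)
    have := integral_im (integrable_cexp_mul hν (x + π * Complex.I))
    simp only [RCLike.im_to_complex] at this
    simp only [complexMGF, id_eq]
    rw [← this]
    refine integral_nonneg_of_ae ?_
    filter_upwards [hν] with a ha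
    simp only [Pi.zero_apply, Complex.exp_im]
    refine mul_nonneg (exp_pos _).le (sin_nonneg_of_nonneg_of_le_pi ?_ ?_)
    · simpa using mul_nonneg pi_pos.le ha.1
    · simpa using mul_le_of_le_one_right pi_pos.le ha.2
  · rw [norm_inv, exp_neg, ← mul_inv]
    exact inv_anti₀ (by positivity) (hlow ζ h0 hπ)
  · have h1 : Tendsto (fun x => κ⁻¹ * rexp (ε * x)) atBot (𝓝 (κ⁻¹ * 0)) :=
      (tendsto_exp_atBot.comp (tendsto_id.const_mul_atBot hε0)).const_mul _
    rw [mul_zero] at h1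
    refine h1.congr' ?_
    filter_upwards [eventually_lt_atBot 0] with x hx
    rw [abs_of_neg hx, mul_left_comm, ← exp_add]
    congr 2
    ring
  · have h1 : Tendsto (fun x => κ⁻¹ * rexp (-(ε * x))) atTop (𝓝 (κ⁻¹ * 0)) :=
      (tendsto_exp_neg_atTop_nhds_zero.comp (tendsto_id.const_mul_atTop hε0)).const_mul _
    rw [mul_zero] at h1
    refine h1.congr' ?_
    filter_upwards [eventually_gt_atTop 0] with x hx
    rw [abs_of_pos hx]
    congr 2
    ring

end UnitSupport

theorem rpow_le_mul_rpow {s₀ s a b : ℝ} (hs₀ : 0 < s₀) (hs : s₀ ≤ s) (ha : 0 ≤ a) (hab : a ≤ b)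
    (hb : b ≤ 1) : s ^ a ≤ max 1 s₀⁻¹ * s ^ b := by
  have hs0 : 0 < s := hs₀.trans_le hs
  rcases le_total 1 s with h1 | h1
  · calc s ^ a ≤ 1 * s ^ b := by
          rw [one_mul]
          exact rpow_le_rpow_of_exponent_le h1 hab
      _ ≤ _ := by
          gcongr
          exact le_max_left _ _
  · calc s ^ a ≤ 1 := rpow_le_one hs0.le h1 ha
      _ = s₀⁻¹ * s₀ := (inv_mul_cancel₀ hs₀.ne').symm
      _ ≤ max 1 s₀⁻¹ * s ^ b := by
        gcongr
        · exact le_max_right _ _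
        · calc s₀ ≤ s ^ (1:ℝ) := by rwa [rpow_one]
            _ ≤ s ^ b := rpow_le_rpow_of_exponent_ge hs0 h1 hb

section UnitSupport

variable {ν : Measure ℝ} [IsFiniteMeasure ν]

theorem integrable_const_rpow (hν : ∀ᵐ a ∂ν, a ∈ Icc (0:ℝ) 1) {s : ℝ} (hs : 0 < s) :
    Integrable (fun a => s ^ a) ν := by
  simpa only [rpow_def_of_pos hs] using integrable_exp_mul_of_ae_mem_Icc hν (log s)

/-- If `ν` charges `[ε, 1]`, then `s ↦ ∫ sᵃ dν(a)` grows at least like a positive power. -/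
theorem exists_mul_integral_rpow_le (hν : ∀ᵐ a ∂ν, a ∈ Icc (0:ℝ) 1) {ε : ℝ}
    (hε0 : 0 < ε) (hmass : 0 < ν.real (Icc ε (1 - ε))) {s₀ : ℝ} (hs₀ : 0 < s₀) :
    ∃ δ : ℝ, 0 < δ ∧ ∀ s, s₀ ≤ s → (1 + δ) * ∫ a, s ^ a ∂ν ≤ ∫ a, (2 * s) ^ a ∂ν := by
  have hε1 : ε ≤ 1 := by
    by_contra! h
    rw [Icc_eq_empty (by linarith), measureReal_empty] at hmass
    exact lt_irrefl _ hmass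
  set K := max 1 s₀⁻¹ with hK
  set b := (2:ℝ) ^ ε - 1 with hb
  set m := ν.real (Icc ε (1 - ε)) with hm
  have hK0 : 0 < K := zero_lt_one.trans_le (le_max_left _ _)
  have hb0 : 0 < b := sub_pos.mpr (one_lt_rpow one_lt_two hε0)
  set A := b⁻¹ + K * ν.real univ * (K / (b * m)) with hA
  have hA0 : 0 < A := by positivity
  refine ⟨A⁻¹, inv_pos.mpr hA0, fun s hs => ?_⟩
  have hs0 : 0 < s := hs₀.trans_le hs
  have hi1 := integrable_const_rpow hν hs0
  have hi2 := integrable_const_rpow hν (mul_pos two_pos hs0)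
  have hi3 : Integrable (fun a => (2 * s) ^ a - s ^ a) ν := hi2.sub hi1
  set D := ∫ a, ((2 * s) ^ a - s ^ a) ∂ν with hD
  have hDeq : D = ∫ a, (2 * s) ^ a ∂ν - ∫ a, s ^ a ∂ν := integral_sub hi2 hi1
  have hbase : ∀ a : ℝ, ε ≤ a → b * s ^ a ≤ (2 * s) ^ a - s ^ a := fun a ha => by
    rw [mul_rpow two_pos.le hs0.le, ← sub_one_mul]
    exact mul_le_mul_of_nonneg_right
      (sub_le_sub_right (rpow_le_rpow_of_exponent_le one_le_two ha) 1) (rpow_nonneg hs0.le a)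
  have hnonneg : ∀ a : ℝ, 0 ≤ a → 0 ≤ (2 * s) ^ a - s ^ a := fun a ha =>
    sub_nonneg.mpr (rpow_le_rpow hs0.le (by linarith) ha)
  have hDlow : b * m * (K⁻¹ * s ^ ε) ≤ D := calc
    _ = ∫ _ in Icc ε (1 - ε), b * (K⁻¹ * s ^ ε) ∂ν := by
      rw [setIntegral_const, smul_eq_mul]
      ring
    _ ≤ ∫ a in Icc ε (1 - ε), ((2 * s) ^ a - s ^ a) ∂ν := by
      refine setIntegral_mono_on integrableOn_const hi3.integrableOn
        measurableSet_Icc fun a ha => le_trans ?_ (hbase a ha.1)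
      gcongr
      rw [inv_mul_le_iff₀ hK0]
      exact rpow_le_mul_rpow hs₀ hs hε0.le ha.1 (by linarith [ha.2])
    _ ≤ D := by
      refine setIntegral_le_integral hi3 ?_
      filter_upwards [hν] with a ha using hnonneg a ha.1
  have hup : ∫ a, s ^ a ∂ν ≤ b⁻¹ * D + K * s ^ ε * ν.real univ := calc
    _ ≤ ∫ a, (b⁻¹ * ((2 * s) ^ a - s ^ a) + K * s ^ ε) ∂ν := by
      refine integral_mono_ae hi1 ((hi3.const_mul _).add (integrable_const _)) ?_
      filter_upwards [hν] with a ha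
      rcases le_total ε a with h | h
      · have h1 : s ^ a ≤ b⁻¹ * ((2 * s) ^ a - s ^ a) := by
          rw [le_inv_mul_iff₀ hb0]
          exact hbase a h
        have h2 : 0 ≤ K * s ^ ε := by positivity
        exact le_add_of_le_of_nonneg h1 h2
      · have h1 := rpow_le_mul_rpow hs₀ hs ha.1 h hε1
        have h2 : 0 ≤ b⁻¹ * ((2 * s) ^ a - s ^ a) :=
          mul_nonneg (inv_nonneg.mpr hb0.le) (hnonneg a ha.1)
        exact le_add_of_nonneg_of_le h2 h1
    _ = _ := by
      rw [integral_add (hi3.const_mul _) (integrable_const _), integral_const_mul,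
        integral_const, smul_eq_mul]
      ring
  have hsε : s ^ ε ≤ K / (b * m) * D := by
    rw [div_mul_eq_mul_div, le_div_iff₀ (by positivity)]
    have := mul_le_mul_of_nonneg_left hDlow hK0.le
    calc s ^ ε * (b * m) = K * (b * m * (K⁻¹ * s ^ ε)) := by field_simp
      _ ≤ K * D := this
  have hfin : ∫ a, s ^ a ∂ν ≤ A * D := calc
    _ ≤ b⁻¹ * D + K * s ^ ε * ν.real univ := hup
    _ ≤ b⁻¹ * D + K * (K / (b * m) * D) * ν.real univ := by gcongr
    _ = A * D := by
      rw [hA]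
      ring
  have : A⁻¹ * ∫ a, s ^ a ∂ν ≤ D := by rwa [inv_mul_le_iff₀ hA0]
  linarith

end UnitSupport

theorem Hker_exp_s4 (μ : Measure ℝ) [IsFiniteMeasure μ]
    (hν : ∀ᵐ a ∂μ.restrict (Ioc 0 1), a ∈ Icc (0:ℝ) 1) (x : ℝ) :
    Hker μ (rexp x) =
      -((complexMGF id (μ.restrict (Ioc 0 1)) (x + π * Complex.I))⁻¹).im := by
  have hint := integrable_cexp_mul hν (x + π * Complex.I)
  have hre := integral_re hint
  have him := integral_im hint
  simp only [RCLike.re_to_complex, RCLike.im_to_complex, Complex.exp_re, Complex.exp_im,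
    Complex.re_mul_ofReal, Complex.im_mul_ofReal, Complex.add_re, Complex.add_im,
    Complex.ofReal_re, Complex.ofReal_im, Complex.re_ofReal_mul, Complex.im_ofReal_mul,
    Complex.I_re, Complex.I_im, mul_zero, mul_one, add_zero, zero_add] at hre him
  rw [Complex.inv_im, Complex.normSq_apply, neg_div, neg_neg]
  simp only [complexMGF, id_eq, ← hre, ← him, Hker, ← exp_mul]
  ring

theorem Hker_nonneg (μ : Measure ℝ) {r : ℝ} (hr : 0 ≤ r) : 0 ≤ Hker μ r := by
  refine div_nonneg (setIntegral_nonneg measurableSet_Ioc fun a ha => ?_) (by positivity)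
  exact mul_nonneg (rpow_nonneg hr _) (sin_nonneg_of_nonneg_of_le_pi
    (mul_nonneg pi_pos.le ha.1.le) (mul_le_of_le_one_right pi_pos.le ha.2))

theorem ae_restrict_Ioc_mem_Icc (μ : Measure ℝ) :
    ∀ᵐ a ∂μ.restrict (Ioc 0 1), a ∈ Icc (0:ℝ) 1 := by
  filter_upwards [ae_restrict_mem measurableSet_Ioc] with a ha using Ioc_subset_Icc_self ha

/-- `∫₀^∞ H(r) / (r + s) dr = π / ∫ sᵃ dμ(a)`. -/
theorem integrableOn_and_integral_Hker_div (μ : Measure ℝ) [IsFiniteMeasure μ] {ε : ℝ}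
    (hε0 : 0 < ε) (hε : ε ≤ 1 / 2) (hmass : 0 < (μ.restrict (Ioc 0 1)).real (Icc ε (1 - ε)))
    {s : ℝ} (hs : 0 < s) :
    IntegrableOn (fun r => Hker μ r / (r + s)) (Ioi 0) ∧
      ∫ r in Ioi (0:ℝ), Hker μ r / (r + s) = π * (∫ a in Ioc (0:ℝ) 1, s ^ a ∂μ)⁻¹ := by
  have hν := ae_restrict_Ioc_mem_Icc μ
  obtain ⟨h1, h2⟩ := integrable_and_integral_inv_complexMGF_id hν hε0 hε hmass (log s)
  simp only [← Hker_exp_s4 μ hν, exp_log hs, mul_div_assoc] at h1 h2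
  have himage : rexp '' univ = Ioi 0 := by rw [image_univ, range_exp]
  have hderiv : ∀ x ∈ (univ : Set ℝ), HasDerivWithinAt rexp (rexp x) univ x :=
    fun x _ => (hasDerivAt_exp x).hasDerivWithinAt
  constructor
  · rw [← himage, integrableOn_image_iff_integrableOn_abs_deriv_smul MeasurableSet.univ hderiv
      exp_injective.injOn, integrableOn_univ]
    simpa only [abs_of_pos (exp_pos _), smul_eq_mul] using h1
  · rw [← himage, integral_image_eq_integral_abs_deriv_smul MeasurableSet.univ hderiv
      exp_injective.injOn, setIntegral_univ]
    simp only [abs_of_pos (exp_pos _), smul_eq_mul]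
    rw [h2]
    simp only [mgf, id_eq, rpow_def_of_pos hs]

theorem IsDistOrderMeasure.exists_mass_Icc {μ : Measure ℝ} [IsFiniteMeasure μ]
    (hμ : IsDistOrderMeasure μ) :
    ∃ ε : ℝ, 0 < ε ∧ ε ≤ 1 / 2 ∧ 0 < (μ.restrict (Ioc 0 1)).real (Icc ε (1 - ε)) := by
  obtain ⟨hne, M, α, q, w, -, hα, -, -, -, hμeq⟩ := hμ
  have hcompl : μ (Ioo 0 1)ᶜ = 0 := by
    rw [hμeq, Measure.add_apply, Measure.finsetSum_apply]
    refine add_eq_zero.mpr ⟨Finset.sum_eq_zero fun n _ => ?_, ?_⟩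
    · rw [Measure.smul_apply, Measure.dirac_apply' _ measurableSet_Ioo.compl]
      simp [(hα n).1, (hα n).2]
    · refine withDensity_absolutelyContinuous _ _ ?_
      rw [Measure.restrict_apply measurableSet_Ioo.compl, compl_inter_self, measure_empty]
  have hpos : μ (Ioo 0 1) ≠ 0 := fun h => hne <| Measure.measure_univ_eq_zero.mp <| by
    rw [← union_compl_self (Ioo (0:ℝ) 1)]
    exact measure_union_null h hcompl
  have hcover : Ioo (0:ℝ) 1 ⊆ ⋃ n : ℕ, Icc (1 / ((n:ℝ) + 2)) (1 - 1 / ((n:ℝ) + 2)) := by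
    intro x hx
    obtain ⟨n, hn⟩ := exists_nat_one_div_lt (lt_min hx.1 (sub_pos.mpr hx.2))
    have hle : 1 / ((n:ℝ) + 2) ≤ 1 / ((n:ℝ) + 1) := by gcongr; norm_num
    have h1 := hn.trans_le (min_le_left _ _)
    have h2 := hn.trans_le (min_le_right _ _)
    exact mem_iUnion.mpr ⟨n, by linarith, by linarith⟩
  have : ∃ n : ℕ, μ (Icc (1 / ((n:ℝ) + 2)) (1 - 1 / ((n:ℝ) + 2))) ≠ 0 := by
    by_contra! h
    exact hpos (measure_mono_null hcover (measure_iUnion_null h))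
  obtain ⟨n, hn⟩ := this
  have hε0 : 0 < 1 / ((n:ℝ) + 2) := by positivity
  refine ⟨1 / ((n:ℝ) + 2), hε0, ?_, ?_⟩
  · gcongr
    linarith [(n.cast_nonneg : (0:ℝ) ≤ n)]
  · rw [measureReal_restrict_apply measurableSet_Icc, inter_eq_self_of_subset_left, measureReal_def]
    · exact ENNReal.toReal_pos hn (measure_ne_top _ _)
    · exact fun x hx => ⟨hε0.trans_le hx.1, by linarith [hx.2]⟩

theorem inv_add_sub_inv_add_le {s r N : ℝ} (hs : 0 < s) (hr : 0 < r) (hN : 0 ≤ N) :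
    1 / (r + s) - 1 / (r + 2 * s) ≤
      rexp N / (2 * s) * rexp (-(r * s⁻¹)) + 1 / (N + 2) * (1 / (r + s)) := by
  have heq : 1 / (r + s) - 1 / (r + 2 * s) = s / ((r + s) * (r + 2 * s)) := by
    field_simp
    ring
  rw [heq]
  rcases le_total r (N * s) with h | h
  · have h1 : s / ((r + s) * (r + 2 * s)) ≤ 1 / (2 * s) := by
      rw [div_le_div_iff₀ (by positivity) (by positivity)]
      nlinarith [mul_pos hr hs]
    have h2 : 1 / (2 * s) ≤ rexp N / (2 * s) * rexp (-(r * s⁻¹)) := by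
      rw [div_mul_eq_mul_div, ← exp_add]
      gcongr
      rw [one_le_exp_iff]
      have : r * s⁻¹ ≤ N := by
        rw [← div_eq_mul_inv, div_le_iff₀ hs]
        exact h
      linarith
    have h3 : 0 ≤ 1 / (N + 2) * (1 / (r + s)) := by positivity
    linarith
  · have h1 : s / ((r + s) * (r + 2 * s)) ≤ 1 / (N + 2) * (1 / (r + s)) := by
      rw [div_mul_div_comm, div_le_div_iff₀ (by positivity) (by positivity)]
      have : s * (N + 2) ≤ r + 2 * s := by linarith
      nlinarith [mul_le_mul_of_nonneg_left this (by positivity : 0 ≤ r + s)]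
    have h3 : 0 ≤ rexp N / (2 * s) * rexp (-(r * s⁻¹)) := by positivity
    linarith

theorem integrableOn_exp_mul_Hker {μ : Measure ℝ} {s : ℝ} (hs : 0 < s)
    (hint : IntegrableOn (fun r => Hker μ r / (r + s)) (Ioi 0)) :
    IntegrableOn (fun r => rexp (-(r * s⁻¹)) * Hker μ r) (Ioi 0) := by
  have heq : EqOn (fun r => ((r + s) * rexp (-(r * s⁻¹))) * (Hker μ r / (r + s)))
      (fun r => rexp (-(r * s⁻¹)) * Hker μ r) (Ioi 0) := fun r hr => by
    have : r + s ≠ 0 := (add_pos hr hs).ne'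
    field_simp
  refine (integrableOn_congr_fun heq measurableSet_Ioi).mp ?_
  refine Integrable.bdd_mul (c := s) hint (by fun_prop) ?_
  filter_upwards [ae_restrict_mem measurableSet_Ioi] with r hr
  have hr' : 0 < r := hr
  rw [Real.norm_of_nonneg (by positivity), exp_neg, ← div_eq_mul_inv, div_le_iff₀ (exp_pos _)]
  calc r + s = s * (r * s⁻¹ + 1) := by field_simp
    _ ≤ s * rexp (r * s⁻¹) := by
      gcongr
      exact add_one_le_exp _

/-- For every `T > 0` there exists `c = c(μ,T) > 0` such that for every `t ∈ (0,T]`,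
`l(t) ≥ c / ∫_{(0,1]} t^{1−α} dμ(α)`. -/
theorem statement4 (μ : Measure ℝ) [IsFiniteMeasure μ] (hμ : IsDistOrderMeasure μ) :
    ∀ T > (0:ℝ), ∃ c : ℝ, 0 < c ∧ ∀ t ∈ Set.Ioc (0:ℝ) T,
      c / (∫ a in Set.Ioc (0:ℝ) 1, t ^ (1 - a) ∂μ) ≤ lker μ t := by
  intro T hT
  obtain ⟨ε, hε0, hε, hmass⟩ := hμ.exists_mass_Icc
  obtain ⟨δ, hδ, hgrowth⟩ := exists_mul_integral_rpow_le (ae_restrict_Ioc_mem_Icc μ) hε0 hmass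
    (inv_pos.mpr hT)
  set η := δ / (2 * (1 + δ)) with hη
  have hη0 : 0 < η := by positivity
  refine ⟨2 * η * rexp (-η⁻¹), by positivity, fun t ht => ?_⟩
  obtain ⟨s, rfl⟩ : ∃ s, t = s⁻¹ := ⟨t⁻¹, (inv_inv t).symm⟩
  have hs : 0 < s := inv_pos.mp ht.1
  have hs₀ : T⁻¹ ≤ s := inv_le_of_inv_le₀ hs ht.2
  obtain ⟨hi1, hv1⟩ := integrableOn_and_integral_Hker_div μ hε0 hε hmass hs
  obtain ⟨hi2, hv2⟩ := integrableOn_and_integral_Hker_div μ hε0 hε hmass (mul_pos two_pos hs)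
  have hiE := integrableOn_exp_mul_Hker hs hi1
  have hg := hgrowth s hs₀
  have hden : ∫ a in Ioc (0:ℝ) 1, s⁻¹ ^ (1 - a) ∂μ = s⁻¹ * ∫ a in Ioc (0:ℝ) 1, s ^ a ∂μ := by
    rw [← integral_const_mul]
    refine integral_congr_ae (Eventually.of_forall fun a => ?_)
    simp only
    rw [rpow_sub (inv_pos.mpr hs), rpow_one, inv_rpow hs.le, div_inv_eq_mul]
  rw [hden]
  set P := ∫ a in Ioc (0:ℝ) 1, s ^ a ∂μ with hP
  have hP0 : 0 < P := by
    have hne : μ.restrict (Ioc 0 1) ≠ 0 := fun h => by simp [h] at hmass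
    have := mgf_pos' (X := id) hne
      (integrable_exp_mul_of_ae_mem_Icc (ae_restrict_Ioc_mem_Icc μ) (log s))
    simpa only [mgf, id_eq, ← rpow_def_of_pos hs] using this
  set E := ∫ r in Ioi (0:ℝ), rexp (-(r * s⁻¹)) * Hker μ r with hE
  have hmain : π * P⁻¹ - π * (∫ a in Ioc (0:ℝ) 1, (2 * s) ^ a ∂μ)⁻¹ ≤
      rexp η⁻¹ / (2 * s) * E + 1 / (η⁻¹ + 2) * (π * P⁻¹) := by
    rw [← hv1, ← hv2, hE, ← integral_sub hi1 hi2, ← integral_const_mul, ← integral_const_mul,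
      ← integral_add (hiE.const_mul _) (hi1.const_mul _)]
    refine setIntegral_mono_on (hi1.sub hi2) ((hiE.const_mul _).add (hi1.const_mul _))
      measurableSet_Ioi fun r hr => ?_
    have := mul_le_mul_of_nonneg_left (inv_add_sub_inv_add_le hs hr (inv_pos.mpr hη0).le)
      (Hker_nonneg μ (le_of_lt hr))
    calc _ = Hker μ r * (1 / (r + s) - 1 / (r + 2 * s)) := by ring
      _ ≤ _ := this
      _ = _ := by ring
  have h2P : (∫ a in Ioc (0:ℝ) 1, (2 * s) ^ a ∂μ)⁻¹ ≤ (1 + δ)⁻¹ * P⁻¹ := by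
    rw [← mul_inv]
    exact inv_anti₀ (by positivity) hg
  have h2P' := mul_le_mul_of_nonneg_left h2P pi_pos.le
  have hη2 : 1 / (η⁻¹ + 2) ≤ η := by
    rw [div_le_iff₀ (by positivity), mul_add, mul_inv_cancel₀ hη0.ne']
    linarith
  have hη3 : (1 + δ)⁻¹ = 1 - 2 * η := by
    rw [hη]
    field_simp
    ring
  have hlow : η * (π * P⁻¹) ≤ rexp η⁻¹ / (2 * s) * E := by
    have := mul_le_mul_of_nonneg_right hη2 (by positivity : 0 ≤ π * P⁻¹)
    rw [hη3] at h2P'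
    linarith
  have hfin := mul_le_mul_of_nonneg_left hlow
    (by positivity : 0 ≤ 1 / π * (2 * s * rexp (-η⁻¹)))
  have hcancel : rexp (-η⁻¹) * rexp η⁻¹ = 1 := by rw [← exp_add, neg_add_cancel, exp_zero]
  calc _ = 1 / π * (2 * s * rexp (-η⁻¹)) * (η * (π * P⁻¹)) := by
        field_simp
    _ ≤ _ := hfin
    _ = (rexp (-η⁻¹) * rexp η⁻¹) * (1 / π * E) := by
        field_simp
    _ = lker μ s⁻¹ := by rw [hcancel, one_mul, lker]
end
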